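/- Let X be a thick locally finite building and let G be a closed subgroup of Aut(X) acting strongly transitively on X. For ξ ∈ Cr(X) let D_ξ := ⋃_{x ∈ Res(X)} Fix_G(Q(x,ξ)), the union of the pointwise fixators in G of the combinatorial sectors pointing to ξ (a closed subgroup of G, equal to the locally finite radical of the stabiliser G_ξ). Then the map ξ ↦ D_ξ is a G-equivariant homeomorphism from Cr(X) onto the group-theoretic compactification Cg(X), the closure in the Chabauty space 𝒮(G) of the set of stabilisers {G_R : R ∈ Res(X)}; more precisely, a sequence (R_n) of spherical residues converges to ξ ∈ Cr(X) if and only if the stabilisers (G_{R_n}) converge to D_ξ in the Chabauty topology. -/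

import Mathlib

open Filter Topology

noncomputable section

variable {B : Type} {W : Type} [Group W] {M : CoxeterMatrix B}

/-- The subset `I` of the simple reflections is of *spherical type* if the standard
parabolic subgroup `W_I` it generates is finite. -/
def SphType (cs : CoxeterSystem M W) (I : Set B) : Prop :=
  ((Subgroup.closure (cs.simple '' I) : Subgroup W) : Set W).Finite

/-- A building of type `(W,S)`, in the chamber-system (`W`-metric) approach:
a nonempty set of chambers with a Weyl-group-valued distance function `delta`. -/
structure Bldg (cs : CoxeterSystem M W) where
  Chamber : Type
  chamber_nonempty : Nonempty Chamber
  delta : Chamber → Chamber → W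
  delta_eq_one_iff : ∀ C D, delta C D = 1 ↔ C = D
  delta_mem_pair : ∀ C D E (i : B), delta D E = cs.simple i →
    delta C E = delta C D * cs.simple i ∨ delta C E = delta C D
  delta_eq_of_length : ∀ C D E (i : B), delta D E = cs.simple i →
    cs.length (delta C D * cs.simple i) = cs.length (delta C D) + 1 →
    delta C E = delta C D * cs.simple i
  exists_delta : ∀ C D (i : B), ∃ E, delta D E = cs.simple i ∧
    delta C E = delta C D * cs.simple i

namespace Bldg

variable {cs : CoxeterSystem M W} (X : Bldg cs)

instance : Nonempty X.Chamber := X.chamber_nonempty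

instance : TopologicalSpace X.Chamber := ⊥
instance : DiscreteTopology X.Chamber := ⟨rfl⟩

/-- The gallery distance between two chambers. -/
def gdist (C D : X.Chamber) : ℕ := cs.length (X.delta C D)

/-- The `I`-residue of the chamber `C`. -/
def residue (I : Set B) (C : X.Chamber) : Set X.Chamber :=
  {D | X.delta C D ∈ Subgroup.closure (cs.simple '' I)}

/-- `R` is a spherical residue. -/
def IsSphResidue (R : Set X.Chamber) : Prop :=
  ∃ (I : Set B) (C : X.Chamber), SphType cs I ∧ R = X.residue I C

/-- `R` is a panel, i.e. an `{s}`-residue. -/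
def IsPanel (R : Set X.Chamber) : Prop :=
  ∃ (i : B) (C : X.Chamber), R = X.residue {i} C

/-- The set `Res(X)` of spherical residues of `X`. -/
def Res : Type := {R : Set X.Chamber // X.IsSphResidue R}

/-- The set of panels of `X`. -/
def Panel : Type := {R : Set X.Chamber // X.IsPanel R}

instance : Nonempty X.Res := by
  obtain ⟨C⟩ := X.chamber_nonempty
  exact ⟨⟨X.residue ∅ C, ∅, C, by simp [SphType], rfl⟩⟩

instance : TopologicalSpace X.Res := ⊥
instance : DiscreteTopology X.Res := ⟨rfl⟩

/-- `R₁ ≤ R₂` : the spherical residue `R₂` contains `R₁`, i.e. `R₂ ⊆ R₁` as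
sets of chambers. -/
def leRes (R₁ R₂ : X.Res) : Prop := R₂.1 ⊆ R₁.1

/-- The star `St(σ)` of a spherical residue. -/
def star (σ : X.Res) : Set X.Res := {τ | X.leRes σ τ}

/-- The gate (combinatorial projection) of the chamber `C` onto the residue `R` :
the unique chamber of `R` through which pass minimal galleries from `C` to any
chamber of `R`. -/
def gate (R : Set X.Chamber) (C : X.Chamber) : X.Chamber :=
  Classical.epsilon fun D => D ∈ R ∧ ∀ E ∈ R, X.gdist C E = X.gdist C D + X.gdist D E

/-- The combinatorial projection of the residue `T` onto the residue `R`,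
as a set of chambers. -/
def projSet (R T : Set X.Chamber) : Set X.Chamber := X.gate R '' T

/-- The combinatorial projection `proj_R(T)` of the spherical residue `T` onto
the spherical residue `R`, as a spherical residue. -/
def projRes (R T : X.Res) : X.Res :=
  Classical.epsilon fun U : X.Res => U.1 = X.projSet R.1 T.1

/-- The map `proj_r : Res(X) → ∏_σ St(σ)` underlying the maximal combinatorial
bordification. -/
def projr (R : X.Res) : X.Res → X.Res := fun σ => X.projRes σ R

/-- The maximal combinatorial bordification `Cr(X)`: the closure of the image
of `proj_r`, each factor of the product being discrete. -/
def Cr : Set (X.Res → X.Res) := closure (Set.range X.projr)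

/-- The map `proj_c : ch(X) → ∏_{σ panel} St(σ)` underlying the minimal
combinatorial bordification. -/
def projc (C : X.Chamber) : X.Panel → X.Chamber := fun σ => X.gate σ.1 C

/-- The minimal combinatorial bordification `Cc(X)`. -/
def Cc : Set (X.Panel → X.Chamber) := closure (Set.range X.projc)

/-- A set of spherical residues is closed if it contains, with any residue,
all residues that it contains (in the order `leRes`). -/
def ClosedResSet (𝓡 : Set X.Res) : Prop :=
  ∀ R₁ R₂ : X.Res, X.leRes R₁ R₂ → R₂ ∈ 𝓡 → R₁ ∈ 𝓡

/-- A set of spherical residues is convex if it is closed and stable under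
combinatorial projections. -/
def ConvexResSet (𝓡 : Set X.Res) : Prop :=
  X.ClosedResSet 𝓡 ∧ ∀ R₁ ∈ 𝓡, ∀ R₂ ∈ 𝓡, X.projRes R₁ R₂ ∈ 𝓡

/-- The closure of a set of spherical residues. -/
def resClosure (𝓡 : Set X.Res) : Set X.Res := ⋂₀ {𝓢 | X.ClosedResSet 𝓢 ∧ 𝓡 ⊆ 𝓢}

/-- The convex hull of a set of spherical residues. -/
def convHull (𝓡 : Set X.Res) : Set X.Res := ⋂₀ {𝓢 | X.ConvexResSet 𝓢 ∧ 𝓡 ⊆ 𝓢}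

/-- The convex hull `Conv(R₁,R₂)` of two spherical residues. -/
def conv2 (R₁ R₂ : X.Res) : Set X.Res := X.convHull {R₁, R₂}

/-- `α : W → ch(X)` is an apartment map: an isometric embedding of the Coxeter
complex. -/
def IsApartMap (α : W → X.Chamber) : Prop :=
  Function.Injective α ∧ ∀ v w : W, X.delta (α v) (α w) = v⁻¹ * w

/-- `A` is an apartment of `X`. -/
def IsApartment (A : Set X.Chamber) : Prop :=
  ∃ α : W → X.Chamber, X.IsApartMap α ∧ A = Set.range α

/-- The residue `R` lies in the apartment `A`. -/
def LiesIn (R : X.Res) (A : Set X.Chamber) : Prop := (R.1 ∩ A).Nonempty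

/-- `φ` is a root (half-apartment) of the apartment `A`. -/
def IsRootOf (A φ : Set X.Chamber) : Prop :=
  ∃ α : W → X.Chamber, X.IsApartMap α ∧ A = Set.range α ∧
    ∃ t : W, cs.IsReflection t ∧ φ = α '' {v : W | cs.length v < cs.length (t * v)}

/-- The residue `R` is contained in the root `φ` of the apartment `A`. -/
def ContainedInRoot (R : X.Res) (A φ : Set X.Chamber) : Prop := R.1 ∩ A ⊆ φ

/-- `Φ_A(R₁,R₂)`: the set of roots of `A` containing `R₁` but not `R₂`. -/
def PhiSep (A : Set X.Chamber) (R₁ R₂ : X.Res) : Set (Set X.Chamber) :=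
  {φ | X.IsRootOf A φ ∧ X.ContainedInRoot R₁ A φ ∧ ¬ X.ContainedInRoot R₂ A φ}

/-- A choice of apartment in which both `R₁` and `R₂` lie. -/
def chooseApt (R₁ R₂ : X.Res) : Set X.Chamber :=
  Classical.epsilon fun A : Set X.Chamber => X.IsApartment A ∧ X.LiesIn R₁ A ∧ X.LiesIn R₂ A

/-- The root-distance between two spherical residues:
`d(R₁,R₂) = ½|Φ_A(R₁,R₂)| + ½|Φ_A(R₂,R₁)|` for an apartment `A` containing both. -/
def rootDist (R₁ R₂ : X.Res) : ℝ :=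
  (((X.PhiSep (X.chooseApt R₁ R₂) R₁ R₂).ncard +
    (X.PhiSep (X.chooseApt R₁ R₂) R₂ R₁).ncard : ℕ) : ℝ) / 2

/-- The interval `[R₁,R₂]` determined by two spherical residues. -/
def interval (R₁ R₂ : X.Res) : Set X.Res :=
  {σ | X.rootDist R₁ R₂ = X.rootDist R₁ σ + X.rootDist σ R₂}

/-- The retraction onto the apartment given by the apartment map `α`, centred at
the chamber `α 1`. -/
def retr (α : W → X.Chamber) (D : X.Chamber) : X.Chamber := α (X.delta (α 1) D)

/-- The retraction onto an apartment, acting on spherical residues: it maps the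
`I`-residue of a chamber `D` to the `I`-residue of the retracted chamber. -/
def retrRes (α : W → X.Chamber) (R : X.Res) : X.Res :=
  Classical.epsilon fun T : X.Res =>
    ∃ (I : Set B) (D : X.Chamber), R.1 = X.residue I D ∧ T.1 = X.residue I (X.retr α D)

/-- The sequence `(R_n)` of spherical residues converges to `ξ` in the maximal
combinatorial bordification. -/
def ConvSeq (ξ : X.Res → X.Res) (R : ℕ → X.Res) : Prop :=
  Tendsto (fun n => X.projr (R n)) atTop (nhds ξ)

/-- `Q(x, (R_n)) = ⋃_k ⋂_{n ≥ k} Conv(x, R_n)`. -/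
def Qseq (x : X.Res) (R : ℕ → X.Res) : Set X.Res :=
  ⋃ k : ℕ, ⋂ n : ℕ, ⋂ _ : k ≤ n, X.conv2 x (R n)

/-- The combinatorial sector `Q(x,ξ)` based at `x` and pointing towards `ξ`. -/
def Qsector (x : X.Res) (ξ : X.Res → X.Res) : Set X.Res :=
  X.Qseq x (Classical.epsilon (X.ConvSeq ξ))

/-- `Φ_A(ξ)`: the set of roots of the apartment `A` (with apartment map `α`) in
which every sequence of residues converging to `ξ`, retracted to `A`, eventually
lies. -/
def PhiXi (A : Set X.Chamber) (α : W → X.Chamber) (ξ : X.Res → X.Res) :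
    Set (Set X.Chamber) :=
  {φ | X.IsRootOf A φ ∧ ∀ R : ℕ → X.Res, X.ConvSeq ξ R →
    ∃ N : ℕ, ∀ n > N, X.ContainedInRoot (X.retrRes α (R n)) A φ}

/-- `Φ_A(x)`: the set of roots of `A` containing the residue `x`. -/
def PhiRes (A : Set X.Chamber) (x : X.Res) : Set (Set X.Chamber) :=
  {φ | X.IsRootOf A φ ∧ X.ContainedInRoot x A φ}

/-- The spherical residue `x` is a chamber (an `∅`-residue). -/
def IsChamberRes (x : X.Res) : Prop :=
  ∃ C : X.Chamber, x.1 = X.residue (∅ : Set B) C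

/-- The automorphism group of the building: all permutations of the chambers
preserving the Weyl distance. -/
def autGroup : Subgroup (Equiv.Perm X.Chamber) where
  carrier := {g | ∀ C D : X.Chamber, X.delta (g C) (g D) = X.delta C D}
  one_mem' := by intro C D; simp
  mul_mem' := by
    intro a b ha hb C D
    simp only [Equiv.Perm.mul_apply]
    rw [ha, hb]
  inv_mem' := by
    intro a ha C D
    have := ha (a⁻¹ C) (a⁻¹ D)
    simpa using this.symm

/-- `Aut(X)` as a type. -/
abbrev Aut : Type := ↥X.autGroup

/-- The topology of pointwise convergence on `Aut(X)` (the chamber set being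
discrete). -/
instance : TopologicalSpace X.Aut :=
  TopologicalSpace.induced
    (fun g : X.Aut => ((g : Equiv.Perm X.Chamber) : X.Chamber → X.Chamber)) inferInstance

/-- The action of an automorphism on spherical residues. -/
def actRes (g : X.Aut) (R : X.Res) : X.Res :=
  Classical.epsilon fun T : X.Res => T.1 = (g : Equiv.Perm X.Chamber) '' R.1

/-- The action of an automorphism on panels. -/
def actPanel (g : X.Aut) (σ : X.Panel) : X.Panel :=
  haveI : Nonempty X.Panel := ⟨σ⟩
  Classical.epsilon fun τ : X.Panel => τ.1 = (g : Equiv.Perm X.Chamber) '' σ.1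

/-- The action of `Aut(X)` on the maximal combinatorial bordification:
`(g·f)(σ) = g·f(g⁻¹σ)`. -/
def actCr (g : X.Aut) (f : X.Res → X.Res) : X.Res → X.Res :=
  fun σ => X.actRes g (f (X.actRes g⁻¹ σ))

/-- The action of `Aut(X)` on the minimal combinatorial bordification. -/
def actCc (g : X.Aut) (f : X.Panel → X.Chamber) : X.Panel → X.Chamber :=
  fun σ => (g : Equiv.Perm X.Chamber) (f (X.actPanel g⁻¹ σ))

/-- The building is locally finite: `S` is finite and panels are finite. -/
def LocallyFinite : Prop :=
  Finite B ∧ ∀ R : Set X.Chamber, X.IsPanel R → R.Finite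

/-- The building is thick: every panel contains at least three chambers. -/
def Thick : Prop := ∀ R : Set X.Chamber, X.IsPanel R → 3 ≤ R.ncard

/-- The subgroup `G ≤ Aut(X)` acts strongly transitively: transitively on pairs
`(C, A)` of a chamber contained in an apartment. -/
def StronglyTransitive (G : Subgroup X.Aut) : Prop :=
  ∀ (C C' : X.Chamber) (A A' : Set X.Chamber),
    X.IsApartment A → C ∈ A → X.IsApartment A' → C' ∈ A' →
    ∃ g ∈ G, (g : Equiv.Perm X.Chamber) C = C' ∧ (g : Equiv.Perm X.Chamber) '' A = A'

end Bldg

/-- A topological group is amenable if there is a left-invariant mean on the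
space of bounded continuous real-valued functions on it. -/
def IsAmenableGroup (H : Type*) [Group H] [TopologicalSpace H] : Prop :=
  ∃ m : BoundedContinuousFunction H ℝ →ₗ[ℝ] ℝ,
    m 1 = 1 ∧ (∀ f : BoundedContinuousFunction H ℝ, (∀ x, 0 ≤ f x) → 0 ≤ m f) ∧
    ∀ (g : H) (f₁ f₂ : BoundedContinuousFunction H ℝ),
      (∀ x, f₂ x = f₁ (g * x)) → m f₂ = m f₁

/-- A subset `K` of a topological group is topologically locally finite if every
finite subset of `K` generates a subgroup with compact closure. -/
def IsTLFSet {H : Type*} [Group H] [TopologicalSpace H] (K : Set H) : Prop :=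
  ∀ s : Finset H, (s : Set H) ⊆ K →
    IsCompact (closure ((Subgroup.closure (s : Set H) : Subgroup H) : Set H))

/-- The space of closed subgroups of a topological group. -/
def ChabautySpace (H : Type*) [Group H] [TopologicalSpace H] : Type _ :=
  {K : Subgroup H // IsClosed (K : Set H)}

instance {H : Type*} [Group H] [TopologicalSpace H] : Nonempty (ChabautySpace H) :=
  ⟨⟨⊤, by rw [Subgroup.coe_top]; exact isClosed_univ⟩⟩

/-- The Chabauty topology on the space of closed subgroups. -/
instance {H : Type*} [Group H] [TopologicalSpace H] : TopologicalSpace (ChabautySpace H) :=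
  TopologicalSpace.generateFrom
    ({s | ∃ K : Set H, IsCompact K ∧ s = {L : ChabautySpace H | (L.1 : Set H) ∩ K = ∅}} ∪
     {s | ∃ U : Set H, IsOpen U ∧ s = {L : ChabautySpace H | ((L.1 : Set H) ∩ U).Nonempty}})

namespace Bldg

variable {cs : CoxeterSystem M W} (X : Bldg cs)

/-- The stabiliser in `G` of a spherical residue, as a set. -/
def gstab (G : Subgroup X.Aut) (R : X.Res) : Set ↥G :=
  {g : ↥G | X.actRes (g : X.Aut) R = R}

/-- The stabiliser in `G` of a spherical residue, as a closed subgroup of `G`. -/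
def gstabC (G : Subgroup X.Aut) (R : X.Res) : ChabautySpace ↥G :=
  Classical.epsilon fun L : ChabautySpace ↥G => (L.1 : Set ↥G) = X.gstab G R

/-- `D_ξ`: the union over `x ∈ Res(X)` of the pointwise fixators in `G` of the
combinatorial sectors `Q(x,ξ)`. -/
def gfixSector (G : Subgroup X.Aut) (ξ : X.Res → X.Res) : Set ↥G :=
  {g : ↥G | ∃ x : X.Res, ∀ R ∈ X.Qsector x ξ, X.actRes (g : X.Aut) R = R}

/-- `D_ξ` as a closed subgroup of `G` (an element of the Chabauty space). -/
def DxiC (G : Subgroup X.Aut) (ξ : X.Res → X.Res) : ChabautySpace ↥G :=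
  Classical.epsilon fun L : ChabautySpace ↥G => (L.1 : Set ↥G) = X.gfixSector G ξ

/-- The set of periodic elements of the stabiliser `G_ξ`. -/
def periodicStab (G : Subgroup X.Aut) (ξ : X.Res → X.Res) : Set ↥G :=
  {g : ↥G | X.actCr (g : X.Aut) ξ = ξ ∧
    IsCompact (closure ((Subgroup.zpowers g : Subgroup ↥G) : Set ↥G))}

/-- The horofunction compactification of the chamber graph, with base point `y₀`. -/
def horoCh (y₀ : X.Chamber) : Set (X.Chamber → ℝ) :=
  closure (Set.range fun C : X.Chamber =>
    fun y : X.Chamber => (X.gdist C y : ℝ) - (X.gdist C y₀ : ℝ))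

/-- The horofunction compactification of `(Res(X), root-distance)`, with base
point `z₀`. -/
def horoRes (z₀ : X.Res) : Set (X.Res → ℝ) :=
  closure (Set.range fun R : X.Res =>
    fun y : X.Res => X.rootDist R y - X.rootDist R z₀)

/-- The action of `Aut(X)` on horofunctions of the chamber graph. -/
def actHoroCh (y₀ : X.Chamber) (g : X.Aut) (h : X.Chamber → ℝ) : X.Chamber → ℝ :=
  fun y => h (((g⁻¹ : X.Aut) : Equiv.Perm X.Chamber) y) -
    h (((g⁻¹ : X.Aut) : Equiv.Perm X.Chamber) y₀)

/-- The action of `Aut(X)` on horofunctions of `(Res(X), root-distance)`. -/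
def actHoroRes (z₀ : X.Res) (g : X.Aut) (h : X.Res → ℝ) : X.Res → ℝ :=
  fun y => h (X.actRes g⁻¹ y) - h (X.actRes g⁻¹ z₀)

end Bldg
namespace CoxeterSystem

variable (cs : CoxeterSystem M W)

open Classical in
/-- The permutation of `W × ZMod 2` attached to a simple reflection, keeping track of inversions. -/
def signPerm (i : B) : Equiv.Perm (W × ZMod 2) where
  toFun p := (cs.simple i * p.1 * cs.simple i, p.2 + if p.1 = cs.simple i then 1 else 0)
  invFun p := (cs.simple i * p.1 * cs.simple i, p.2 + if p.1 = cs.simple i then 1 else 0)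
  left_inv p := by
    have h : cs.simple i * p.1 * cs.simple i = cs.simple i ↔ p.1 = cs.simple i := by
      rw [mul_eq_right, mul_eq_one_iff_eq_inv', inv_simple]
    ext
    · simp [mul_assoc]
    · simp only [h]
      split_ifs
      · rw [add_assoc, CharTwo.add_self_eq_zero, add_zero]
      · simp
  right_inv p := by
    have h : cs.simple i * p.1 * cs.simple i = cs.simple i ↔ p.1 = cs.simple i := by
      rw [mul_eq_right, mul_eq_one_iff_eq_inv', inv_simple]
    ext
    · simp [mul_assoc]
    · simp only [h]
      split_ifs
      · rw [add_assoc, CharTwo.add_self_eq_zero, add_zero]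
      · simp

open Classical in
theorem signPerm_apply (i : B) (t : W) (e : ZMod 2) :
    cs.signPerm i (t, e) =
      (cs.simple i * t * cs.simple i, e + if t = cs.simple i then 1 else 0) := rfl

open Classical in
theorem signPerm_mul_pow (i j : B) (n : ℕ) (t : W) (e : ZMod 2) :
    ((cs.signPerm i * cs.signPerm j) ^ n) (t, e) =
      ((cs.simple i * cs.simple j) ^ n * t * ((cs.simple i * cs.simple j) ^ n)⁻¹,
        e + ∑ l ∈ Finset.range (n + n),
          if t = cs.simple j * (cs.simple i * cs.simple j) ^ l then 1 else 0) := by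
  set c := cs.simple i * cs.simple j with hc
  have hjc : cs.simple j * c * cs.simple j = c⁻¹ := by
    simp [hc, mul_assoc]
  have hjcn : ∀ k : ℕ, cs.simple j * c ^ k * cs.simple j = (c ^ k)⁻¹ := by
    intro k
    have := conj_pow (a := cs.simple j) (b := c) (i := k)
    rw [inv_simple, hjc] at this
    rw [← this, inv_pow]
  have hjcn' : ∀ k : ℕ, cs.simple j * c ^ k = (c ^ k)⁻¹ * cs.simple j := by
    intro k
    rw [← hjcn]; simp [mul_assoc]
  induction n with
  | zero => simp
  | succ n ih =>
    rw [pow_succ', Equiv.Perm.mul_apply, ih, Equiv.Perm.mul_apply, signPerm_apply, signPerm_apply]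
    have e1 : (c ^ n * t * (c ^ n)⁻¹ = cs.simple j) ↔ t = cs.simple j * c ^ (n + n) := by
      rw [pow_add, ← mul_assoc, hjcn', mul_inv_eq_iff_eq_mul, mul_assoc, ← eq_inv_mul_iff_mul_eq]
    have e2 : (cs.simple j * (c ^ n * t * (c ^ n)⁻¹) * cs.simple j = cs.simple i) ↔
        t = cs.simple j * c ^ (n + n + 1) := by
      have : cs.simple j * c ^ (n + n + 1) = (c ^ n)⁻¹ * (cs.simple j * cs.simple i * cs.simple j)
          * c ^ n := by
        rw [show n + n + 1 = n + 1 + n by ring, pow_add, pow_succ]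
        rw [← mul_assoc, ← mul_assoc, hjcn']
        simp [hc, mul_assoc]
      rw [this]
      constructor
      · intro h; rw [← h]; simp [mul_assoc]
      · intro h; rw [h]; simp [mul_assoc]
    ext
    · simp [hc, mul_assoc, pow_succ']
    · rw [show n + 1 + (n + 1) = n + n + 1 + 1 by ring, Finset.sum_range_succ,
        Finset.sum_range_succ]
      simp only [e1, e2, add_assoc]

theorem signPerm_isLiftable : M.IsLiftable cs.signPerm := by
  classical
  intro i j
  ext ⟨t, e⟩ : 1
  rw [signPerm_mul_pow, Finset.sum_range_add, simple_mul_simple_pow]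
  simp [pow_add, CharTwo.add_self_eq_zero]

/-- The action of `W` on `W × ZMod 2` keeping track of inversions. -/
def signRep : W →* Equiv.Perm (W × ZMod 2) := cs.lift ⟨cs.signPerm, cs.signPerm_isLiftable⟩

theorem signRep_simple (i : B) : cs.signRep (cs.simple i) = cs.signPerm i :=
  cs.lift_apply_simple cs.signPerm_isLiftable i

open Classical in
theorem signRep_wordProd (ω : List B) (t : W) (e : ZMod 2) :
    cs.signRep (cs.wordProd ω) (t, e) =
      (cs.wordProd ω * t * (cs.wordProd ω)⁻¹, e + (cs.rightInvSeq ω).count t) := by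
  induction ω generalizing t e with
  | nil => simp
  | cons i ω ih =>
    rw [wordProd_cons, map_mul, Equiv.Perm.mul_apply, ih, signRep_simple, signPerm_apply,
      rightInvSeq, List.count_cons]
    have : (cs.wordProd ω * t * (cs.wordProd ω)⁻¹ = cs.simple i) ↔
        (cs.wordProd ω)⁻¹ * cs.simple i * cs.wordProd ω = t := by
      constructor
      · intro h; rw [← h]; simp [mul_assoc]
      · intro h; rw [← h]; simp [mul_assoc]
    ext
    · simp [mul_assoc]
    · simp only [this, beq_iff_eq, Nat.cast_add, Nat.cast_ite, Nat.cast_one, Nat.cast_zero,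
        add_assoc]

/-- The parity of the number of times a word for `w` crosses `t`. -/
def sgn (w t : W) : ZMod 2 := (cs.signRep w (t, 0)).2

theorem signRep_apply (w t : W) (e : ZMod 2) :
    cs.signRep w (t, e) = (w * t * w⁻¹, e + cs.sgn w t) := by
  classical
  obtain ⟨ω, rfl⟩ := cs.wordProd_surjective w
  simp [sgn, signRep_wordProd]

theorem sgn_mul (u v t : W) : cs.sgn (u * v) t = cs.sgn v t + cs.sgn u (v * t * v⁻¹) := by
  have := cs.signRep_apply (u * v) t 0
  rw [map_mul, Equiv.Perm.mul_apply, signRep_apply, signRep_apply] at this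
  simpa using (congrArg Prod.snd this).symm

theorem sgn_one (t : W) : cs.sgn 1 t = 0 := by simp [sgn]

theorem sgn_reflection {t : W} (ht : cs.IsReflection t) : cs.sgn t t = 1 := by
  obtain ⟨u, i, rfl⟩ := ht
  have h1 := cs.sgn_mul u u⁻¹ (u * cs.simple i * u⁻¹)
  have h2 : cs.sgn (cs.simple i) (cs.simple i) = 1 := by
    simp [sgn, signRep_simple, signPerm_apply]
  rw [mul_inv_cancel, sgn_one] at h1
  rw [sgn_mul, sgn_mul]
  simp only [mul_assoc, inv_inv, inv_mul_cancel, mul_one, inv_mul_cancel_left, inv_simple] at h1 ⊢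
  simp only [simple_mul_simple_self, mul_one, h2] at h1 ⊢
  rw [add_left_comm, ← h1, add_zero]

theorem sgn_eq_one_iff {t : W} (ht : cs.IsReflection t) (w : W) :
    cs.sgn w t = 1 ↔ cs.length (w * t) < cs.length w := by
  classical
  have key : ∀ w, cs.sgn w t = 1 → cs.length (w * t) < cs.length w := by
    intro w h
    obtain ⟨ω, hω, rfl⟩ := cs.exists_isReduced w
    have : t ∈ cs.rightInvSeq ω := by
      by_contra hn
      rw [sgn, signRep_wordProd, List.count_eq_zero_of_not_mem hn] at h
      simp at h
    exact (cs.isRightInversion_of_mem_rightInvSeq hω this).2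
  refine ⟨key w, fun h => ?_⟩
  by_contra hn
  have h0 : cs.sgn w t = 0 := by
    revert hn; generalize cs.sgn w t = x; revert x; decide
  have h1 : cs.sgn (w * t) t = 1 := by
    rw [sgn_mul, sgn_reflection cs ht, ht.mul_self, one_mul, ht.inv, h0, add_zero]
  have := key _ h1
  rw [mul_assoc, ht.mul_self, mul_one] at this
  omega

/-- `t` is a left descent of `w`, for an arbitrary element `t`. -/
def Dn (t w : W) : Prop := cs.length (t * w) < cs.length w

theorem dn_iff_sgn {t : W} (ht : cs.IsReflection t) (w : W) :
    cs.Dn t w ↔ cs.sgn w⁻¹ t = 1 := by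
  rw [sgn_eq_one_iff cs ht, Dn, length_inv, ← cs.length_inv (w⁻¹ * t), mul_inv_rev, inv_inv, ht.inv]

theorem dn_mul {t : W} (ht : cs.IsReflection t) (u v : W) :
    cs.Dn t (u * v) ↔ ¬ (cs.Dn t u ↔ cs.Dn (u⁻¹ * t * u) v) := by
  have h2 : cs.IsReflection (u⁻¹ * t * u) := by simpa using ht.conj u⁻¹
  rw [dn_iff_sgn cs ht, dn_iff_sgn cs ht, dn_iff_sgn cs h2, mul_inv_rev, sgn_mul, inv_inv]
  generalize cs.sgn u⁻¹ t = x
  generalize cs.sgn v⁻¹ (u⁻¹ * t * u) = y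
  revert x y; decide

theorem exists_eraseIdx_of_dn {t : W} (ht : cs.IsReflection t) {ω : List B}
    (h : cs.Dn t (cs.wordProd ω)) : ∃ j < ω.length,
      t * cs.wordProd ω = cs.wordProd (ω.eraseIdx j) := by
  classical
  rw [dn_iff_sgn cs ht, ← wordProd_reverse] at h
  have hmem : t ∈ cs.leftInvSeq ω := by
    by_contra hn
    rw [sgn, signRep_wordProd, rightInvSeq_reverse, List.count_eq_zero_of_not_mem] at h
    · simp at h
    · simpa using hn
  obtain ⟨j, hj, rfl⟩ := List.mem_iff_getElem.1 hmem
  rw [length_leftInvSeq] at hj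
  refine ⟨j, hj, ?_⟩
  rw [← getD_leftInvSeq_mul_wordProd, List.getD_eq_getElem]

end CoxeterSystem

namespace CoxeterSystem

variable (cs : CoxeterSystem M W)

/-- The standard parabolic subgroup of type `T`. -/
abbrev para (T : Set B) : Subgroup W := Subgroup.closure (cs.simple '' T)

theorem simple_mem_para {T : Set B} {i : B} (hi : i ∈ T) : cs.simple i ∈ cs.para T :=
  Subgroup.subset_closure ⟨i, hi, rfl⟩

theorem para_mono {T T' : Set B} (h : T ⊆ T') : cs.para T ≤ cs.para T' :=
  Subgroup.closure_mono (Set.image_mono h)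

theorem dn_simple_iff (i : B) (w : W) :
    cs.Dn (cs.simple i) w ↔ cs.length (cs.simple i * w) + 1 = cs.length w := by
  rcases cs.length_simple_mul w i with h | h <;> unfold Dn <;> omega

theorem not_dn_simple_iff (i : B) (w : W) :
    ¬ cs.Dn (cs.simple i) w ↔ cs.length (cs.simple i * w) = cs.length w + 1 := by
  rcases cs.length_simple_mul w i with h | h <;> unfold Dn <;> omega

theorem dn_simple_mul (i : B) (w : W) :
    cs.Dn (cs.simple i) (cs.simple i * w) ↔ ¬ cs.Dn (cs.simple i) w := by
  unfold Dn
  rw [simple_mul_simple_cancel_left]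
  have := cs.length_simple_mul_ne w i
  omega

theorem exists_word_of_mem_para {T : Set B} {x : W} (hx : x ∈ cs.para T) :
    ∃ ω : List B, (∀ i ∈ ω, i ∈ T) ∧ x = cs.wordProd ω := by
  induction hx using Subgroup.closure_induction with
  | mem x h =>
    obtain ⟨i, hi, rfl⟩ := h
    exact ⟨[i], by simpa using hi, by simp⟩
  | one => exact ⟨[], by simp, by simp⟩
  | mul x y _ _ hx hy =>
    obtain ⟨ω, h1, rfl⟩ := hx
    obtain ⟨ω', h2, rfl⟩ := hy
    refine ⟨ω ++ ω', fun i hi => ?_, by simp [wordProd_append]⟩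
    rcases List.mem_append.1 hi with h | h
    exacts [h1 i h, h2 i h]
  | inv x _ hx =>
    obtain ⟨ω, h1, rfl⟩ := hx
    exact ⟨ω.reverse, fun i hi => h1 i (List.mem_reverse.1 hi), by simp [wordProd_reverse]⟩

theorem exists_dn_of_mem_para {T : Set B} {x : W} (hx : x ∈ cs.para T) (h1 : x ≠ 1) :
    ∃ i ∈ T, cs.Dn (cs.simple i) x := by
  obtain ⟨ω, hω, rfl⟩ := cs.exists_word_of_mem_para hx
  clear hx
  induction h : ω.length using Nat.strong_induction_on generalizing ω with
  | _ n ih =>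
  cases ω with
  | nil => simp at h1
  | cons i ω =>
    by_cases hd : cs.Dn (cs.simple i) (cs.wordProd (i :: ω))
    · exact ⟨i, hω i (by simp), hd⟩
    · rw [wordProd_cons, dn_simple_mul, not_not] at hd
      obtain ⟨j, hj, he⟩ := cs.exists_eraseIdx_of_dn (cs.isReflection_simple i) hd
      rw [wordProd_cons, he] at h1 ⊢
      refine ih _ ?_ _ (fun k hk => hω k (List.mem_cons_of_mem _ (List.mem_of_mem_eraseIdx hk))) h1 rfl
      rw [← h, List.length_cons]
      have := List.length_eraseIdx_le ω j
      omega

theorem exists_eq_simple {T : Set B} {x : W} (hx : x ∈ cs.para T) (h : cs.length x = 1) :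
    ∃ i ∈ T, x = cs.simple i := by
  obtain ⟨i, hi, hd⟩ := cs.exists_dn_of_mem_para hx (by rintro rfl; simp at h)
  refine ⟨i, hi, ?_⟩
  unfold Dn at hd
  rw [h, Nat.lt_one_iff, length_eq_zero_iff, mul_eq_one_iff_eq_inv', inv_simple] at hd
  exact hd

/-- `y` is the shortest element of `W_T y`. -/
def LMin (T : Set B) (y : W) : Prop := ∀ i ∈ T, ¬ cs.Dn (cs.simple i) y

/-- `v` is the shortest element of `v W_I`. -/
def RMin (I : Set B) (v : W) : Prop := cs.LMin I v⁻¹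

theorem dn_mul_of_forall {T : Set B} {x y : W} (hx : x ∈ cs.para T)
    (hy : ∀ r ∈ cs.para T, cs.IsReflection r → ¬ cs.Dn r y) {t : W} (ht : cs.IsReflection t)
    (htT : t ∈ cs.para T) : cs.Dn t (x * y) ↔ cs.Dn t x := by
  have := hy (x⁻¹ * t * x) (mul_mem (mul_mem (inv_mem hx) htT) hx) (by simpa using ht.conj x⁻¹)
  rw [dn_mul cs ht]
  tauto

theorem length_mul_of_forall {T : Set B} {x y : W} (hx : x ∈ cs.para T)
    (hy : ∀ r ∈ cs.para T, cs.IsReflection r → ¬ cs.Dn r y) :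
    cs.length (x * y) = cs.length x + cs.length y := by
  induction h : cs.length x using Nat.strong_induction_on generalizing x with
  | _ n ih =>
  by_cases h1 : x = 1
  · subst h1; simp at h; simp [← h]
  obtain ⟨i, hi, hd⟩ := cs.exists_dn_of_mem_para hx h1
  have hd2 := (cs.dn_mul_of_forall hx hy (cs.isReflection_simple i) (cs.simple_mem_para hi)).2 hd
  rw [dn_simple_iff] at hd hd2
  have := ih _ (by omega) (mul_mem (cs.simple_mem_para hi) hx) rfl
  rw [mul_assoc] at this
  omega

theorem exists_mul_forall (T : Set B) (w : W) : ∃ x ∈ cs.para T, ∃ y, w = x * y ∧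
    ∀ r ∈ cs.para T, cs.IsReflection r → ¬ cs.Dn r y := by
  induction h : cs.length w using Nat.strong_induction_on generalizing w with
  | _ n ih =>
  by_cases hw : ∀ r ∈ cs.para T, cs.IsReflection r → ¬ cs.Dn r w
  · exact ⟨1, one_mem _, w, by simp, hw⟩
  · push Not at hw
    obtain ⟨r, hr, hr', hd⟩ := hw
    obtain ⟨x, hx, y, hxy, hy⟩ := ih _ (h ▸ (show cs.length (r * w) < cs.length w from hd)) _ rfl
    refine ⟨r * x, mul_mem hr hx, y, ?_, hy⟩
    rw [mul_assoc, ← hxy, ← mul_assoc, hr'.mul_self, one_mul]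

theorem LMin.forall {T : Set B} {y : W} (hy : cs.LMin T y) :
    ∀ r ∈ cs.para T, cs.IsReflection r → ¬ cs.Dn r y := by
  obtain ⟨x, hx, z, rfl, hz⟩ := cs.exists_mul_forall T y
  by_cases h1 : x = 1
  · subst h1; simpa using hz
  · obtain ⟨i, hi, hd⟩ := cs.exists_dn_of_mem_para hx h1
    exact (hy i hi ((cs.dn_mul_of_forall hx hz (cs.isReflection_simple i)
      (cs.simple_mem_para hi)).2 hd)).elim

theorem LMin.length_mul {T : Set B} {x y : W} (hy : cs.LMin T y) (hx : x ∈ cs.para T) :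
    cs.length (x * y) = cs.length x + cs.length y := cs.length_mul_of_forall hx hy.forall

theorem exists_lmin (T : Set B) (w : W) : ∃ x ∈ cs.para T, ∃ y, w = x * y ∧ cs.LMin T y := by
  obtain ⟨x, hx, y, h, hy⟩ := cs.exists_mul_forall T w
  exact ⟨x, hx, y, h, fun i hi => hy _ (cs.simple_mem_para hi) (cs.isReflection_simple i)⟩

variable {cs}

theorem RMin.length_mul {I : Set B} {v x : W} (hv : cs.RMin I v) (hx : x ∈ cs.para I) :
    cs.length (v * x) = cs.length v + cs.length x := by
  have := LMin.length_mul cs hv (inv_mem hx)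
  rw [← mul_inv_rev, length_inv, length_inv, length_inv] at this
  omega

variable (cs) in
theorem exists_rmin (I : Set B) (w : W) : ∃ v, cs.RMin I v ∧ ∃ x ∈ cs.para I, w = v * x := by
  obtain ⟨x, hx, y, h, hy⟩ := cs.exists_lmin I w⁻¹
  refine ⟨y⁻¹, by simpa [RMin] using hy, x⁻¹, inv_mem hx, ?_⟩
  rw [← mul_inv_rev, ← h, inv_inv]

theorem rmin_one (I : Set B) : cs.RMin I 1 := by
  intro i _
  simp [Dn]

theorem RMin.eq {I : Set B} {v v' : W} (hv : cs.RMin I v) (hv' : cs.RMin I v')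
    (h : v⁻¹ * v' ∈ cs.para I) : v = v' := by
  have h1 := hv.length_mul h
  have h2 := hv'.length_mul (inv_mem h)
  simp only [mul_inv_cancel_left, mul_inv_rev, inv_inv] at h1 h2
  have h3 : cs.length (v⁻¹ * v') = 0 := by omega
  rw [length_eq_zero_iff, inv_mul_eq_one] at h3
  exact h3

theorem RMin.not_dn {I : Set B} {v t : W} (hv : cs.RMin I v) (h : v⁻¹ * t * v ∈ cs.para I) :
    ¬ cs.Dn t v := by
  have := hv.length_mul h
  rw [← mul_assoc, mul_assoc v⁻¹, mul_inv_cancel_left] at this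
  unfold Dn
  omega

theorem RMin.exists_simple {I : Set B} {v : W} {i : B} (hv : cs.RMin I v)
    (h : v⁻¹ * cs.simple i * v ∈ cs.para I) : ∃ j ∈ I, v⁻¹ * cs.simple i * v = cs.simple j := by
  have h1 := hv.length_mul h
  rw [← mul_assoc, mul_assoc v⁻¹, mul_inv_cancel_left] at h1
  have h2 := (cs.not_dn_simple_iff i v).1 (hv.not_dn h)
  exact cs.exists_eq_simple h (by rw [mul_assoc]; omega)

theorem RMin.simple_mul_of_dn {I : Set B} {v : W} {i : B} (hv : cs.RMin I v)
    (h : cs.Dn (cs.simple i) v) : cs.RMin I (cs.simple i * v) := by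
  intro j hj hd
  have h1 := hv j hj
  rw [not_dn_simple_iff, ← length_inv, mul_inv_rev, inv_inv, inv_simple, length_inv] at h1
  rw [dn_simple_iff, ← length_inv, mul_inv_rev, inv_inv, inv_simple, length_inv, mul_assoc] at hd
  rw [dn_simple_iff] at h
  have := cs.length_simple_mul (v * cs.simple j) i
  omega

/-- Deodhar: multiplying a shortest coset representative by a simple reflection that makes it
longer either gives a shortest coset representative or stays in the coset. -/
theorem RMin.simple_mul {I : Set B} {v : W} {i : B} (hv : cs.RMin I v)
    (h : v⁻¹ * cs.simple i * v ∉ cs.para I) : cs.RMin I (cs.simple i * v) := by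
  by_cases hd : cs.Dn (cs.simple i) v
  · exact hv.simple_mul_of_dn hd
  intro j hj hd'
  have h1 := hv j hj
  rw [not_dn_simple_iff, ← length_inv, mul_inv_rev, inv_inv, inv_simple] at h1
  rw [dn_simple_iff, ← length_inv, mul_inv_rev, inv_inv, inv_simple, length_inv, mul_assoc] at hd'
  have h2 : cs.Dn (cs.simple i) (v * cs.simple j) := by
    rw [not_dn_simple_iff] at hd
    rw [length_inv] at h1
    unfold Dn
    omega
  rw [dn_mul cs (cs.isReflection_simple i)] at h2
  have h3 : cs.Dn (v⁻¹ * cs.simple i * v) (cs.simple j) := by tauto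
  unfold Dn at h3
  rw [length_simple, Nat.lt_one_iff, length_eq_zero_iff, mul_eq_one_iff_eq_inv, inv_simple] at h3
  exact h (h3 ▸ cs.simple_mem_para hj)

variable (cs) in
/-- The left weak order on `W`: `u` is an initial piece of a reduced word for `v`. -/
def Pre (u v : W) : Prop := cs.length u + cs.length (u⁻¹ * v) = cs.length v

theorem pre_refl (u : W) : cs.Pre u u := by simp [Pre]

theorem pre_one (u : W) : cs.Pre 1 u := by simp [Pre]

theorem pre_simple_iff {i : B} {w : W} : cs.Pre (cs.simple i) w ↔ cs.Dn (cs.simple i) w := by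
  rw [dn_simple_iff, Pre, length_simple, inv_simple, add_comm]

theorem Pre.length_le {u v : W} (h : cs.Pre u v) : cs.length u ≤ cs.length v := by
  unfold Pre at h; omega

theorem Pre.eq_of_length_le {u v : W} (h : cs.Pre u v) (h' : cs.length v ≤ cs.length u) :
    u = v := by
  have : cs.length (u⁻¹ * v) = 0 := by unfold Pre at h; omega
  rwa [length_eq_zero_iff, inv_mul_eq_one] at this

theorem Pre.antisymm {u v : W} (h : cs.Pre u v) (h' : cs.Pre v u) : u = v :=
  h.eq_of_length_le h'.length_le

/-- If `c` precedes `d` then `d` precedes `v` as soon as `c⁻¹d` precedes `c⁻¹v` and `c` precedes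
`v`. -/
theorem Pre.of_inv_mul {c d v : W} (h1 : cs.Pre c v) (h3 : cs.Pre (c⁻¹ * d) (c⁻¹ * v)) :
    cs.Pre d v ∧ cs.Pre c d := by
  unfold Pre at *
  have e : (c⁻¹ * d)⁻¹ * (c⁻¹ * v) = d⁻¹ * v := by group
  rw [e] at h3
  have := cs.length_mul_le c (c⁻¹ * d)
  have h4 := cs.length_mul_le d (d⁻¹ * v)
  rw [mul_inv_cancel_left] at this h4
  omega

theorem Pre.inv_mul {c d v : W} (h1 : cs.Pre c d) (h3 : cs.Pre d v) :
    cs.Pre c v ∧ cs.Pre (c⁻¹ * d) (c⁻¹ * v) := by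
  unfold Pre at *
  have e : (c⁻¹ * d)⁻¹ * (c⁻¹ * v) = d⁻¹ * v := by group
  rw [e]
  have := cs.length_mul_le c (c⁻¹ * v)
  have h4 := cs.length_mul_le (c⁻¹ * d) (d⁻¹ * v)
  rw [mul_inv_cancel_left] at this
  rw [show c⁻¹ * d * (d⁻¹ * v) = c⁻¹ * v by group] at h4
  omega

theorem Pre.trans {c d v : W} (h1 : cs.Pre c d) (h3 : cs.Pre d v) : cs.Pre c v :=
  (h1.inv_mul h3).1

theorem Pre.rmin {I : Set B} {u v : W} (h : cs.Pre u v) (hv : cs.RMin I v) :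
    cs.RMin I (u⁻¹ * v) := by
  intro j hj hd
  have h1 := hv j hj
  rw [not_dn_simple_iff, ← length_inv, mul_inv_rev, inv_inv, inv_simple, length_inv] at h1
  rw [dn_simple_iff, ← length_inv, mul_inv_rev, inv_inv, inv_simple, length_inv, mul_assoc] at hd
  have := cs.length_mul_le u (u⁻¹ * (v * cs.simple j))
  rw [mul_inv_cancel_left] at this
  unfold Pre at h
  omega

variable (cs) in
/-- `k` is the longest element of the parabolic subgroup of type `T`. -/
def IsLongest (T : Set B) (k : W) : Prop := k ∈ cs.para T ∧ ∀ x ∈ cs.para T, cs.Pre x k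

theorem pre_of_forall_dn {T : Set B} {w : W} (h : ∀ i ∈ T, cs.Dn (cs.simple i) w) {x : W}
    (hx : x ∈ cs.para T) : cs.Pre x w := by
  induction hn : cs.length x using Nat.strong_induction_on generalizing x with
  | _ n ih =>
  by_cases h1 : x = 1
  · subst h1; exact pre_one w
  obtain ⟨i, hi, hd⟩ := cs.exists_dn_of_mem_para hx h1
  set z := cs.simple i * x with hz
  have hxz : x = cs.simple i * z := by simp [hz]
  have hp : cs.Pre z w := by
    refine ih _ ?_ (mul_mem (cs.simple_mem_para hi) hx) rfl
    rw [← hn]; exact hd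
  have hzd : ¬ cs.Dn (cs.simple i) z := by rw [hz, dn_simple_mul, not_not]; exact hd
  have h2 := h i hi
  rw [← mul_inv_cancel_left z w, dn_mul cs (cs.isReflection_simple i)] at h2
  have h3 : cs.Dn (z⁻¹ * cs.simple i * z) (z⁻¹ * w) := by tauto
  unfold Dn at h3
  rw [show z⁻¹ * cs.simple i * z * (z⁻¹ * w) = x⁻¹ * w by rw [hxz]; simp [mul_assoc]] at h3
  have h4 := cs.length_mul_le x (x⁻¹ * w)
  rw [mul_inv_cancel_left] at h4
  rw [dn_simple_iff, ← hz] at hd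
  unfold Pre at *
  omega

theorem exists_isLongest {T : Set B} {w : W} (h : ∀ i ∈ T, cs.Dn (cs.simple i) w) :
    ∃ k, cs.IsLongest T k ∧ cs.Pre k w ∧ cs.LMin T (k⁻¹ * w) := by
  obtain ⟨k, hk, y, rfl, hy⟩ := cs.exists_lmin T w
  refine ⟨k, ⟨hk, fun x hx => ?_⟩, pre_of_forall_dn h hk, by simpa using hy⟩
  refine pre_of_forall_dn (fun i hi => ?_) hx
  exact (cs.dn_mul_of_forall hk hy.forall (cs.isReflection_simple i)
    (cs.simple_mem_para hi)).1 (h i hi)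

theorem IsLongest.unique {T : Set B} {k k' : W} (h : cs.IsLongest T k) (h' : cs.IsLongest T k') :
    k = k' := (h'.2 k h.1).antisymm (h.2 k' h'.1)

theorem IsLongest.inv_eq {T : Set B} {k : W} (h : cs.IsLongest T k) : k⁻¹ = k := by
  refine (h.2 _ (inv_mem h.1)).eq_of_length_le ?_
  rw [length_inv]

theorem IsLongest.dn {T : Set B} {k : W} (h : cs.IsLongest T k) {i : B} (hi : i ∈ T) :
    cs.Dn (cs.simple i) k := pre_simple_iff.1 (h.2 _ (cs.simple_mem_para hi))

theorem IsLongest.conj {T : Set B} {k : W} (h : cs.IsLongest T k) {i : B} (hi : i ∈ T) :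
    ∃ j ∈ T, k * cs.simple i * k = cs.simple j := by
  have h1 : k * cs.simple i * k ∈ cs.para T :=
    mul_mem (mul_mem h.1 (cs.simple_mem_para hi)) h.1
  refine cs.exists_eq_simple h1 ?_
  have h2 := h.2 (cs.simple i * k) (mul_mem (cs.simple_mem_para hi) h.1)
  have h3 := (cs.dn_simple_iff i k).1 (h.dn hi)
  unfold Pre at h2
  rw [mul_inv_rev, inv_simple, h.inv_eq] at h2
  omega

theorem IsLongest.length_mul {T : Set B} {k : W} (h : cs.IsLongest T k) {x : W}
    (hx : x ∈ cs.para T) : cs.length (k * x) + cs.length x = cs.length k := by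
  have := h.2 x hx
  unfold Pre at this
  rw [← length_inv cs (x⁻¹ * k), mul_inv_rev, inv_inv, h.inv_eq] at this
  omega

/-- The parabolic subgroup generated by a set of left descents is finite. -/
theorem finite_para [Finite B] {T : Set B} {w : W} (h : ∀ i ∈ T, cs.Dn (cs.simple i) w) :
    (cs.para T : Set W).Finite := by
  have : {x : W | cs.length x ≤ cs.length w}.Finite := by
    refine (((List.finite_length_le B (cs.length w)).image cs.wordProd)).subset ?_
    intro x hx
    obtain ⟨ω, hω, rfl⟩ := cs.exists_isReduced x
    exact ⟨ω, by rw [Set.mem_ofPred_eq, ← hω.eq]; exact hx, rfl⟩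
  exact this.subset fun x hx => (pre_of_forall_dn h hx).length_le

theorem exists_isLongest_of_finite {T : Set B} (h : (cs.para T : Set W).Finite) :
    ∃ k, cs.IsLongest T k := by
  obtain ⟨k, hk, hm⟩ := Set.exists_max_image _ cs.length h ⟨1, one_mem _⟩
  refine ⟨k, hk, fun x hx => pre_of_forall_dn (fun i hi => ?_) hx⟩
  have := hm _ (mul_mem (cs.simple_mem_para hi) hk)
  have := cs.length_simple_mul_ne k i
  unfold Dn
  omega

/-- A family of elements has a greatest lower bound in the weak order. -/
theorem exists_inf {ι : Type*} [Nonempty ι] (v : ι → W) :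
    ∃ u, (∀ n, cs.Pre u (v n)) ∧ ∀ d, (∀ n, cs.Pre d (v n)) → cs.Pre d u := by
  obtain ⟨n₀⟩ := ‹Nonempty ι›
  suffices H : ∀ c, (∀ n, cs.Pre c (v n)) → ∃ u, (∀ n, cs.Pre u (v n)) ∧ cs.Pre c u ∧
      ∀ d, (∀ n, cs.Pre d (v n)) → cs.Pre c d → cs.Pre d u by
    obtain ⟨u, h1, -, h2⟩ := H 1 fun n => pre_one _
    exact ⟨u, h1, fun d hd => h2 d hd (pre_one _)⟩
  intro c hc
  induction h : cs.length (v n₀) - cs.length c using Nat.strong_induction_on generalizing c with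
  | _ n ih =>
  have step : ∀ i, (∀ n, cs.Dn (cs.simple i) (c⁻¹ * v n)) →
      (∀ n, cs.Pre (c * cs.simple i) (v n)) ∧ cs.Pre c (c * cs.simple i) ∧
      ∃ u, (∀ n, cs.Pre u (v n)) ∧ cs.Pre (c * cs.simple i) u ∧
      ∀ d, (∀ n, cs.Pre d (v n)) → cs.Pre (c * cs.simple i) d → cs.Pre d u := by
    intro i hi
    have h1 : ∀ n, cs.Pre (c * cs.simple i) (v n) ∧ cs.Pre c (c * cs.simple i) := fun n =>
      (hc n).of_inv_mul (by rw [inv_mul_cancel_left]; exact pre_simple_iff.2 (hi n))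
    refine ⟨fun n => (h1 n).1, (h1 n₀).2, ih _ ?_ _ (fun n => (h1 n).1) rfl⟩
    have h2 := (h1 n₀).1.length_le
    have h3 := (h1 n₀).2
    unfold Pre at h3
    rw [inv_mul_cancel_left, length_simple] at h3
    omega
  have first : ∀ d, (∀ n, cs.Pre d (v n)) → cs.Pre c d → d ≠ c →
      ∃ i, (∀ n, cs.Dn (cs.simple i) (c⁻¹ * v n)) ∧ cs.Pre (c * cs.simple i) d := by
    intro d hd hcd hne
    obtain ⟨i, hi⟩ := cs.exists_leftDescent_of_ne_one (w := c⁻¹ * d)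
      (by rw [Ne, inv_mul_eq_one]; exact fun h => hne h.symm)
    have hi' : cs.Pre (cs.simple i) (c⁻¹ * d) := pre_simple_iff.2 hi
    refine ⟨i, fun n => pre_simple_iff.1 (hi'.trans (hcd.inv_mul (hd n)).2), ?_⟩
    exact (hcd.of_inv_mul (by rw [inv_mul_cancel_left]; exact hi')).1
  by_cases hex : ∃ i, ∀ n, cs.Dn (cs.simple i) (c⁻¹ * v n)
  · obtain ⟨i, hi⟩ := hex
    obtain ⟨hi1, hi2, u, hu1, hu2, hu3⟩ := step i hi
    refine ⟨u, hu1, hi2.trans hu2, fun d hd hcd => ?_⟩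
    by_cases hdc : d = c
    · subst hdc; exact hi2.trans hu2
    obtain ⟨j, hj, hjd⟩ := first d hd hcd hdc
    obtain ⟨hj1, hj2, u', hu1', hu2', hu3'⟩ := step j hj
    have hij : ∀ n, ∀ k ∈ ({i, j} : Set B), cs.Dn (cs.simple k) (c⁻¹ * v n) := by
      rintro n k (rfl | rfl)
      exacts [hi n, hj n]
    obtain ⟨k, hk, -, -⟩ := exists_isLongest (hij n₀)
    have hk1 : ∀ n, cs.Pre (c * k) (v n) := fun n =>
      ((hc n).of_inv_mul (by rw [inv_mul_cancel_left]; exact pre_of_forall_dn (hij n) hk.1)).1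
    have hck : cs.Pre c (c * k) := ((hc n₀).of_inv_mul (by
      rw [inv_mul_cancel_left]; exact pre_of_forall_dn (hij n₀) hk.1)).2
    have hki : cs.Pre (c * cs.simple i) (c * k) := (hck.of_inv_mul (by
      rw [inv_mul_cancel_left, inv_mul_cancel_left]
      exact hk.2 _ (cs.simple_mem_para (by simp)))).1
    have hkj : cs.Pre (c * cs.simple j) (c * k) := (hck.of_inv_mul (by
      rw [inv_mul_cancel_left, inv_mul_cancel_left]
      exact hk.2 _ (cs.simple_mem_para (by simp)))).1
    have h4 := hu3' u hu1 (hkj.trans (hu3 _ hk1 hki))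
    have h5 := hu3 u' hu1' (hki.trans (hu3' _ hk1 hkj))
    rw [h4.antisymm h5]
    exact hu3' d hd hjd
  · refine ⟨c, hc, pre_refl c, fun d hd hcd => ?_⟩
    by_cases hdc : d = c
    · subst hdc; exact pre_refl _
    · obtain ⟨i, hi, -⟩ := first d hd hcd hdc
      exact (hex ⟨i, hi⟩).elim

end CoxeterSystem

namespace CoxeterSystem

variable {cs : CoxeterSystem M W}

/-- If a simple reflection fixes all cosets `v n W_(I n)`, then it is conjugate, under the greatest
lower bound of the `v n`, to a simple reflection. -/
theorem exists_simple_of_inf {ι : Type*} [Nonempty ι] {v : ι → W} {I : ι → Set B}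
    (hv : ∀ n, cs.RMin (I n) (v n)) {i : B}
    (hi : ∀ n, (v n)⁻¹ * cs.simple i * v n ∈ cs.para (I n)) {u : W}
    (hu : ∀ n, cs.Pre u (v n)) (hu' : ∀ d, (∀ n, cs.Pre d (v n)) → cs.Pre d u) :
    ∃ r, cs.simple i * u = u * cs.simple r := by
  obtain ⟨n₀⟩ := id ‹Nonempty ι›
  have hnd : ∀ n, ¬ cs.Dn (cs.simple i) (v n) := fun n => (hv n).not_dn (hi n)
  have hs : ∀ n, cs.Pre (cs.simple i) (cs.simple i * v n) := fun n =>
    pre_simple_iff.2 ((cs.dn_simple_mul i (v n)).2 (hnd n))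
  have hvs : ∀ n, cs.Pre (v n) (cs.simple i * v n) := fun n => by
    obtain ⟨j, hj, he⟩ := (hv n).exists_simple (hi n)
    unfold Pre
    rw [← mul_assoc, he, length_simple, (cs.not_dn_simple_iff i (v n)).1 (hnd n)]
  obtain ⟨m, hm, hm'⟩ := exists_inf (cs := cs) fun n => cs.simple i * v n
  have h1 : cs.Pre (cs.simple i) m := hm' _ hs
  have h2 : cs.Pre (cs.simple i * m) u := hu' _ fun n => by
    have := (h1.inv_mul (hm n)).2
    rwa [inv_simple, simple_mul_simple_cancel_left] at this
  have h3 : cs.Pre u m := hm' _ fun n => (hu n).trans (hvs n)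
  have h4 : ∀ n, cs.Pre (cs.simple i * u) (cs.simple i * v n) ∧
      cs.Pre (cs.simple i) (cs.simple i * u) := fun n => (hs n).of_inv_mul (by
    rw [inv_simple, simple_mul_simple_cancel_left, simple_mul_simple_cancel_left]; exact hu n)
  have h5 : cs.Pre (cs.simple i * u) m := hm' _ fun n => (h4 n).1
  have h6 := (cs.dn_simple_iff i m).1 (pre_simple_iff.1 h1)
  have h7 := h2.length_le
  have h9 := (h4 n₀).2
  unfold Pre at h9
  rw [inv_simple, simple_mul_simple_cancel_left, length_simple] at h9
  have h8 : cs.simple i * u = m := h5.eq_of_length_le (by omega)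
  have h10 : cs.length (u⁻¹ * m) = 1 := by
    unfold Pre at h3
    rw [h8] at h9
    omega
  obtain ⟨r, hr⟩ := cs.length_eq_one_iff.1 h10
  exact ⟨r, by rw [h8, ← hr, mul_inv_cancel_left]⟩

theorem mem_para_of_dn {I : Set B} {r z : W} (hr : cs.IsReflection r) (hz : z ∈ cs.para I)
    (h : cs.Dn r z) : r ∈ cs.para I := by
  obtain ⟨ω, hω, rfl⟩ := cs.exists_word_of_mem_para hz
  obtain ⟨j, -, he⟩ := cs.exists_eraseIdx_of_dn hr h
  have h2 : ∀ ω : List B, (∀ i ∈ ω, i ∈ I) → cs.wordProd ω ∈ cs.para I := by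
    intro ω
    induction ω with
    | nil => simp [one_mem]
    | cons i ω ih =>
      intro h
      rw [wordProd_cons]
      exact mul_mem (cs.simple_mem_para (h i (by simp))) (ih fun k hk => h k (by simp [hk]))
  have h3 := h2 (ω.eraseIdx j) fun i hi => hω i (List.mem_of_mem_eraseIdx hi)
  rw [← he] at h3
  exact (Subgroup.mul_mem_cancel_right _ hz).1 h3

theorem mem_para_of_conj {I J : Set B} {x y : W} (hx : x ∈ cs.para J)
    (hJ : cs.LMin J y) (h : y⁻¹ * x * y ∈ cs.para I) :
    x ∈ cs.para {t ∈ J | y⁻¹ * cs.simple t * y ∈ cs.para I} := by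
  induction hn : cs.length x using Nat.strong_induction_on generalizing x with
  | _ n ih =>
  by_cases h1 : x = 1
  · subst h1; exact one_mem _
  obtain ⟨t, ht, hd⟩ := cs.exists_dn_of_mem_para hx h1
  have h2 := (cs.dn_mul_of_forall hx hJ.forall (cs.isReflection_simple t)
    (cs.simple_mem_para ht)).2 hd
  rw [show x * y = y * (y⁻¹ * x * y) by group, dn_mul cs (cs.isReflection_simple t)] at h2
  have h3 : cs.Dn (y⁻¹ * cs.simple t * y) (y⁻¹ * x * y) := by
    have := hJ t ht
    tauto
  have h4 : y⁻¹ * cs.simple t * y ∈ cs.para I :=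
    mem_para_of_dn (by simpa using (cs.isReflection_simple t).conj y⁻¹) h h3
  have h5 := ih _ (hn ▸ show cs.length (cs.simple t * x) < cs.length x from hd)
    (mul_mem (cs.simple_mem_para ht) hx)
    (by rw [show y⁻¹ * (cs.simple t * x) * y = (y⁻¹ * cs.simple t * y) * (y⁻¹ * x * y) by group]
        exact mul_mem h4 h) rfl
  have h6 : t ∈ {t ∈ J | y⁻¹ * cs.simple t * y ∈ cs.para I} := ⟨ht, h4⟩
  exact (Subgroup.mul_mem_cancel_left _ (cs.simple_mem_para h6)).1 h5

theorem LMin.length_mul' {T : Set B} {x y : W} (hy : cs.LMin T y) (hx : x ∈ cs.para T)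
    (h : cs.LMin T (x * y)) : x = 1 := by
  by_contra h1
  obtain ⟨i, hi, hd⟩ := cs.exists_dn_of_mem_para hx h1
  exact h i hi ((cs.dn_mul_of_forall hx hy.forall (cs.isReflection_simple i)
    (cs.simple_mem_para hi)).2 hd)

end CoxeterSystem

namespace Bldg

open CoxeterSystem

variable {cs : CoxeterSystem M W} (X : Bldg cs)

theorem delta_self (C : X.Chamber) : X.delta C C = 1 := (X.delta_eq_one_iff C C).2 rfl

theorem delta_simple_symm {C D : X.Chamber} {i : B} (h : X.delta C D = cs.simple i) :
    X.delta D C = cs.simple i := by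
  rcases X.delta_mem_pair D C D i h with h1 | h1
  · rw [delta_self] at h1
    rw [eq_comm, mul_eq_one_iff_eq_inv, inv_simple] at h1
    exact h1
  · rw [delta_self, eq_comm, delta_eq_one_iff] at h1
    subst h1
    exact h

theorem delta_add {C D E : X.Chamber}
    (h : cs.length (X.delta C D * X.delta D E) =
      cs.length (X.delta C D) + cs.length (X.delta D E)) :
    X.delta C E = X.delta C D * X.delta D E := by
  induction hn : cs.length (X.delta D E) using Nat.strong_induction_on generalizing E with
  | _ n ih =>
  by_cases h1 : X.delta D E = 1
  · have := (X.delta_eq_one_iff D E).1 h1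
    subst this
    rw [h1, mul_one]
  obtain ⟨i, hi⟩ := cs.exists_rightDescent_of_ne_one h1
  obtain ⟨F, hF1, hF2⟩ := X.exists_delta D E i
  rw [isRightDescent_iff, ← hF2] at hi
  have h3 : X.delta D E = X.delta D F * cs.simple i := by rw [hF2]; simp
  have h4 := cs.length_mul_simple (X.delta C D * X.delta D F) i
  have h5 := cs.length_mul_le (X.delta C D) (X.delta D F)
  rw [mul_assoc, ← h3] at h4
  have h6 := ih _ (by omega) (E := F) (by omega) rfl
  rw [h3, ← mul_assoc, ← h6]
  refine X.delta_eq_of_length C F E i (X.delta_simple_symm hF1) ?_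
  rw [h6, mul_assoc, ← h3]
  omega

theorem delta_symm (C D : X.Chamber) : X.delta D C = (X.delta C D)⁻¹ := by
  induction hn : cs.length (X.delta C D) using Nat.strong_induction_on generalizing D with
  | _ n ih =>
  by_cases h1 : X.delta C D = 1
  · have := (X.delta_eq_one_iff C D).1 h1
    subst this
    rw [h1, inv_one]
  obtain ⟨i, hi⟩ := cs.exists_rightDescent_of_ne_one h1
  obtain ⟨F, hF1, hF2⟩ := X.exists_delta C D i
  rw [isRightDescent_iff, ← hF2] at hi
  have h2 := ih _ (by omega) F rfl
  have h3 : X.delta D F * X.delta F C = (X.delta C D)⁻¹ := by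
    rw [h2, hF2, hF1]; simp
  rw [← h3]
  refine X.delta_add ?_
  rw [h3, length_inv, h2, length_inv, hF1, length_simple]
  omega

theorem exists_delta_eq (C : X.Chamber) (w : W) : ∃ D, X.delta C D = w := by
  induction w using cs.simple_induction_right with
  | one => exact ⟨C, X.delta_self C⟩
  | mul_simple_right w i ih =>
    obtain ⟨D, rfl⟩ := ih
    obtain ⟨E, -, h⟩ := X.exists_delta C D i
    exact ⟨E, h⟩

theorem delta_left_pair {C D : X.Chamber} {i : B} (h : X.delta C D = cs.simple i)
    (E : X.Chamber) : X.delta C E = cs.simple i * X.delta D E ∨ X.delta C E = X.delta D E := by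
  have := X.delta_mem_pair E D C i (X.delta_simple_symm h)
  rw [X.delta_symm E C, X.delta_symm E D]
  rcases this with h | h
  · left; rw [h]; simp
  · right; rw [h]

theorem delta_left_of_not_dn {C D : X.Chamber} {i : B} (h : X.delta C D = cs.simple i)
    {E : X.Chamber} (hn : ¬ cs.Dn (cs.simple i) (X.delta D E)) :
    X.delta C E = cs.simple i * X.delta D E := by
  rw [not_dn_simple_iff] at hn
  rw [← h]
  refine X.delta_add ?_
  rw [h, hn, length_simple, add_comm]

theorem exists_between {C E : X.Chamber} {u : W} (h : cs.Pre u (X.delta C E)) :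
    ∃ D, X.delta C D = u ∧ X.delta D E = u⁻¹ * X.delta C E := by
  induction hn : cs.length (u⁻¹ * X.delta C E) using Nat.strong_induction_on generalizing E with
  | _ n ih =>
  by_cases h1 : u⁻¹ * X.delta C E = 1
  · refine ⟨E, ?_, by rw [delta_self, h1]⟩
    rw [inv_mul_eq_one] at h1; exact h1.symm
  obtain ⟨i, hi⟩ := cs.exists_rightDescent_of_ne_one h1
  obtain ⟨F, hF1, hF2⟩ := X.exists_delta C E i
  rw [isRightDescent_iff, mul_assoc, ← hF2] at hi
  have h3 := cs.length_mul_le u (u⁻¹ * X.delta C F)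
  rw [mul_inv_cancel_left] at h3
  have h4 := cs.length_mul_simple (X.delta C E) i
  rw [← hF2] at h4
  have hp : cs.Pre u (X.delta C F) := by unfold Pre at *; omega
  obtain ⟨D, hD1, hD2⟩ := ih _ (by omega) hp rfl
  refine ⟨D, hD1, ?_⟩
  have h5 : X.delta D F * X.delta F E = u⁻¹ * X.delta C E := by
    rw [hD2, X.delta_simple_symm hF1, hF2]; simp [mul_assoc]
  rw [← h5]
  refine X.delta_add ?_
  rw [h5, hD2, X.delta_simple_symm hF1, length_simple]
  omega

theorem eq_of_between {C D D' E : X.Chamber} (h : cs.Pre (X.delta C D) (X.delta C E))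
    (h1 : X.delta C D = X.delta C D') (h2 : X.delta D E = (X.delta C D)⁻¹ * X.delta C E)
    (h3 : X.delta D' E = X.delta D E) : D = D' := by
  induction hn : cs.length (X.delta D E) using Nat.strong_induction_on generalizing D D' with
  | _ n ih =>
  by_cases h4 : X.delta D E = 1
  · rw [h4, delta_eq_one_iff] at h3
    rw [delta_eq_one_iff] at h4
    rw [h4, h3]
  obtain ⟨i, hi⟩ := cs.exists_leftDescent_of_ne_one h4
  have hdn : cs.Pre (cs.simple i) (X.delta D E) := pre_simple_iff.2 hi
  have hdn' : cs.Pre (cs.simple i) (X.delta D' E) := by rwa [h3]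
  obtain ⟨F, hF1, hF2⟩ := X.exists_between hdn
  obtain ⟨F', hF1', hF2'⟩ := X.exists_between hdn'
  have hp : cs.Pre (X.delta C D * cs.simple i) (X.delta C E) ∧
      cs.Pre (X.delta C D) (X.delta C D * cs.simple i) := h.of_inv_mul (by
    rw [inv_mul_cancel_left, ← h2]; exact hdn)
  have hl : cs.length (X.delta C D * cs.simple i) = cs.length (X.delta C D) + 1 := by
    have := hp.2
    unfold Pre at this
    rw [inv_mul_cancel_left, length_simple] at this
    exact this.symm
  have hCF := X.delta_eq_of_length C D F i hF1 hl
  have hCF' := X.delta_eq_of_length C D' F' i hF1' (by rw [← h1]; exact hl)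
  have hFF : F = F' := by
    refine ih (cs.length (X.delta F E)) ?_ ?_ ?_ ?_ ?_ rfl
    · rw [hF2, inv_simple, ← hn]; exact hi
    · rw [hCF]; exact hp.1
    · rw [hCF, hCF', h1]
    · rw [hF2, hCF, h2]; simp [mul_assoc]
    · rw [hF2, hF2', h3]
  subst hFF
  rcases X.delta_mem_pair D F D' i (X.delta_simple_symm hF1') with h5 | h5
  · rw [hF1, simple_mul_simple_self, delta_eq_one_iff] at h5
    exact h5
  · rw [hF1] at h5
    have := X.delta_eq_of_length C D D' i h5 hl
    rw [← h1] at this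
    simp only [left_eq_mul] at this
    have h6 := cs.length_simple i
    rw [this, length_one] at h6
    omega

theorem delta_coset {I : Set B} (C : X.Chamber) {D E : X.Chamber}
    (h : X.delta D E ∈ cs.para I) : (X.delta C D)⁻¹ * X.delta C E ∈ cs.para I := by
  induction hn : cs.length (X.delta D E) using Nat.strong_induction_on generalizing E with
  | _ n ih =>
  by_cases h1 : X.delta D E = 1
  · have := (X.delta_eq_one_iff D E).1 h1
    subst this
    rw [inv_mul_cancel]; exact one_mem _
  obtain ⟨i, hi, hd⟩ := cs.exists_dn_of_mem_para (inv_mem h) (by simpa using h1)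
  obtain ⟨F, hF1, hF2⟩ := X.exists_delta D E i
  have h3 := ih (cs.length (X.delta D F)) (by
    unfold Dn at hd
    rw [length_inv, ← length_inv, mul_inv_rev, inv_inv, inv_simple, ← hF2] at hd
    omega) (hF2 ▸ mul_mem h (cs.simple_mem_para hi)) rfl
  rcases X.delta_mem_pair C F E i (X.delta_simple_symm hF1) with h4 | h4
  · rw [h4, ← mul_assoc]
    exact mul_mem h3 (cs.simple_mem_para hi)
  · rwa [h4]

theorem mem_residue {I : Set B} {C D : X.Chamber} :
    D ∈ X.residue I C ↔ X.delta C D ∈ cs.para I := Iff.rfl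

theorem self_mem_residue (I : Set B) (C : X.Chamber) : C ∈ X.residue I C := by
  rw [mem_residue, delta_self]; exact one_mem _

theorem residue_eq {I : Set B} {C D : X.Chamber} (h : D ∈ X.residue I C) :
    X.residue I C = X.residue I D := by
  ext E
  rw [mem_residue] at *
  have h' : X.delta D C ∈ cs.para I := by rw [X.delta_symm]; exact inv_mem h
  constructor
  · intro hE
    exact (Subgroup.mul_mem_cancel_left _ (inv_mem h')).1 (X.delta_coset D hE)
  · intro hE
    exact (Subgroup.mul_mem_cancel_left _ (inv_mem h)).1 (X.delta_coset C hE)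

theorem residue_mono {I J : Set B} (h : I ⊆ J) (C : X.Chamber) :
    X.residue I C ⊆ X.residue J C := fun _ hD => cs.para_mono h hD

theorem para_eq_of_residue_eq {I J : Set B} {C : X.Chamber} (h : X.residue I C = X.residue J C) :
    cs.para I = cs.para J := by
  ext x
  obtain ⟨D, rfl⟩ := X.exists_delta_eq C x
  rw [← mem_residue, h, mem_residue]

theorem exists_gate (I : Set B) (C D : X.Chamber) :
    ∃ E ∈ X.residue I D, cs.RMin I (X.delta C E) := by
  obtain ⟨v, hv, x, hx, h⟩ := cs.exists_rmin I (X.delta C D)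
  have hp : cs.Pre v (X.delta C D) := by
    unfold Pre
    rw [h, inv_mul_cancel_left, hv.length_mul hx]
  obtain ⟨E, hE1, hE2⟩ := X.exists_between hp
  refine ⟨E, ?_, by rwa [hE1]⟩
  rw [h, inv_mul_cancel_left] at hE2
  rw [mem_residue, X.delta_symm, hE2]
  exact inv_mem hx

theorem delta_eq_mul {I : Set B} {C E F : X.Chamber} (hE : cs.RMin I (X.delta C E))
    (hF : X.delta E F ∈ cs.para I) : X.delta C F = X.delta C E * X.delta E F :=
  X.delta_add (hE.length_mul hF)

theorem gate_eq {I : Set B} {C D E : X.Chamber} (hE : E ∈ X.residue I D)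
    (h : cs.RMin I (X.delta C E)) : X.gate (X.residue I D) C = E := by
  have key : ∀ F ∈ X.residue I D, X.gdist C F = X.gdist C E + X.gdist E F := by
    intro F hF
    rw [X.residue_eq hE] at hF
    unfold gdist
    rw [X.delta_eq_mul h hF, h.length_mul hF]
  have h2 := Classical.epsilon_spec
    (p := fun D' => D' ∈ X.residue I D ∧ ∀ F ∈ X.residue I D,
      X.gdist C F = X.gdist C D' + X.gdist D' F) ⟨E, hE, key⟩
  change X.gate (X.residue I D) C ∈ _ ∧ _ at h2
  have h3 := key _ h2.1
  have h4 := h2.2 E hE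
  change _ = X.gdist C (X.gate (X.residue I D) C) + X.gdist (X.gate (X.residue I D) C) E at h4
  have h5 : X.gdist E (X.gate (X.residue I D) C) = 0 := by omega
  unfold gdist at h5
  rw [length_eq_zero_iff, delta_eq_one_iff] at h5
  exact h5.symm

end Bldg

namespace Bldg

open CoxeterSystem

variable {cs : CoxeterSystem M W} (X : Bldg cs)

/-- The spherical residue of type `I` containing `C`. -/
def resOf (I : Set B) (hI : SphType cs I) (C : X.Chamber) : X.Res := ⟨X.residue I C, I, C, hI, rfl⟩

theorem _root_.SphType.mono {I J : Set B} (h : SphType cs J) (hIJ : I ⊆ J) : SphType cs I :=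
  h.subset (cs.para_mono hIJ)

variable {X}

/-- A type of the spherical residue `R`. -/
def typ (R : X.Res) : Set B := R.2.choose

theorem typ_sph (R : X.Res) : SphType cs (typ R) := R.2.choose_spec.choose_spec.1

theorem eq_residue {R : X.Res} {C : X.Chamber} (h : C ∈ R.1) : R.1 = X.residue (typ R) C := by
  have h2 : R.1 = X.residue (typ R) _ := R.2.choose_spec.choose_spec.2
  rw [h2] at h
  rw [← X.residue_eq h, ← h2]

theorem res_nonempty (R : X.Res) : R.1.Nonempty := by
  obtain ⟨I, C, -, h⟩ := R.2
  exact ⟨C, h ▸ X.self_mem_residue I C⟩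

theorem mem_iff {R : X.Res} {C D : X.Chamber} (h : C ∈ R.1) :
    D ∈ R.1 ↔ X.delta C D ∈ cs.para (typ R) := by rw [eq_residue h, mem_residue]

theorem gate_spec (R : X.Res) (C : X.Chamber) :
    X.gate R.1 C ∈ R.1 ∧ cs.RMin (typ R) (X.delta C (X.gate R.1 C)) := by
  obtain ⟨D, hD⟩ := res_nonempty R
  obtain ⟨E, hE, h⟩ := X.exists_gate (typ R) C D
  have h2 := X.gate_eq hE h
  rw [← eq_residue hD] at h2 hE
  rw [h2]
  exact ⟨hE, h⟩

/-- The Weyl distance from the chamber `C` to its gate in `R`. -/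
def mm (R : X.Res) (C : X.Chamber) : W := X.delta C (X.gate R.1 C)

theorem gate_mem (R : X.Res) (C : X.Chamber) : X.gate R.1 C ∈ R.1 := (gate_spec R C).1

theorem mm_rmin (R : X.Res) (C : X.Chamber) : cs.RMin (typ R) (mm R C) := (gate_spec R C).2

theorem gate_eq_of_rmin {R : X.Res} {C E : X.Chamber} (hE : E ∈ R.1)
    (h : cs.RMin (typ R) (X.delta C E)) : X.gate R.1 C = E := by
  rw [eq_residue hE]
  exact X.gate_eq (X.self_mem_residue _ _) h

theorem delta_gate_mem {R : X.Res} (C : X.Chamber) {E : X.Chamber} (hE : E ∈ R.1) :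
    X.delta (X.gate R.1 C) E ∈ cs.para (typ R) := (mem_iff (gate_mem R C)).1 hE

theorem delta_of_mem {R : X.Res} (C : X.Chamber) {E : X.Chamber} (hE : E ∈ R.1) :
    X.delta C E = mm R C * X.delta (X.gate R.1 C) E :=
  X.delta_eq_mul (mm_rmin R C) (delta_gate_mem C hE)

theorem mm_pre {R : X.Res} (C : X.Chamber) {E : X.Chamber} (hE : E ∈ R.1) :
    cs.Pre (mm R C) (X.delta C E) := by
  unfold Pre
  rw [delta_of_mem C hE, inv_mul_cancel_left, (mm_rmin R C).length_mul (delta_gate_mem C hE)]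

theorem mm_eq_of_coset {R : X.Res} {C E : X.Chamber} {w : W} (hE : E ∈ R.1)
    (hw : cs.RMin (typ R) w) (h : w⁻¹ * X.delta C E ∈ cs.para (typ R)) : mm R C = w := by
  refine (hw.eq (mm_rmin R C) ?_).symm
  rw [delta_of_mem C hE, ← mul_assoc] at h
  exact (Subgroup.mul_mem_cancel_right _ (delta_gate_mem C hE)).1 h

section Adjacent

variable {R : X.Res} {c c' : X.Chamber} {i : B}

theorem mm_adj_flat (h : X.delta c c' = cs.simple i)
    (hf : (mm R c)⁻¹ * cs.simple i * mm R c ∈ cs.para (typ R)) : mm R c' = mm R c := by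
  have hd := X.delta_left_pair (X.delta_simple_symm h) (X.gate R.1 c)
  refine mm_eq_of_coset (gate_mem R c) (mm_rmin R c) ?_
  rcases hd with h1 | h1
  · rw [h1, ← mul_assoc]; exact hf
  · rw [h1]
    change (mm R c)⁻¹ * mm R c ∈ _
    rw [inv_mul_cancel]; exact one_mem _

theorem mm_adj_of_not_flat (h : X.delta c c' = cs.simple i)
    (hf : (mm R c)⁻¹ * cs.simple i * mm R c ∉ cs.para (typ R)) :
    X.gate R.1 c' = X.gate R.1 c := by
  refine gate_eq_of_rmin (gate_mem R c) ?_
  rcases X.delta_left_pair (X.delta_simple_symm h) (X.gate R.1 c) with h1 | h1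
  · rw [h1]; exact (mm_rmin R c).simple_mul hf
  · rw [h1]; exact mm_rmin R c

theorem mm_adj_pair (R : X.Res) (h : X.delta c c' = cs.simple i) :
    mm R c' = cs.simple i * mm R c ∨ mm R c' = mm R c := by
  by_cases hf : (mm R c)⁻¹ * cs.simple i * mm R c ∈ cs.para (typ R)
  · exact Or.inr (mm_adj_flat h hf)
  · have := X.delta_left_pair (X.delta_simple_symm h) (X.gate R.1 c)
    unfold mm
    rwa [mm_adj_of_not_flat h hf]

theorem mm_adj_up (h : X.delta c c' = cs.simple i) (hd : ¬ cs.Dn (cs.simple i) (mm R c))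
    (hf : (mm R c)⁻¹ * cs.simple i * mm R c ∉ cs.para (typ R)) :
    mm R c' = cs.simple i * mm R c := by
  unfold mm
  rw [mm_adj_of_not_flat h hf]
  exact X.delta_left_of_not_dn (X.delta_simple_symm h) hd

end Adjacent

theorem gate_eq_of_between {R : X.Res} {c b : X.Chamber} (hk : cs.Pre (X.delta c b) (mm R c))
    (h : mm R b = (X.delta c b)⁻¹ * mm R c) : X.gate R.1 c = X.gate R.1 b := by
  have h1 : X.delta c (X.gate R.1 b) = mm R c := by
    have : X.delta c b * X.delta b (X.gate R.1 b) = mm R c := by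
      change X.delta c b * mm R b = _
      rw [h, mul_inv_cancel_left]
    rw [← this]
    refine X.delta_add ?_
    rw [this]
    change _ = _ + cs.length (mm R b)
    rw [h]
    exact hk.symm
  exact gate_eq_of_rmin (gate_mem R b) (h1 ▸ mm_rmin R c)

theorem exists_lift (R : X.Res) (c : X.Chamber) {k : W} (hk : cs.Pre k (mm R c)) :
    ∃ b, X.delta c b = k ∧ mm R b = k⁻¹ * mm R c := by
  obtain ⟨b, h1, h2⟩ := X.exists_between hk
  refine ⟨b, h1, ?_⟩
  have : X.gate R.1 b = X.gate R.1 c := by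
    refine gate_eq_of_rmin (gate_mem R c) ?_
    rw [h2]
    exact hk.rmin (mm_rmin R c)
  unfold mm
  rw [this, h2]

theorem lift_unique {R : X.Res} {c b b' : X.Chamber} (hk : cs.Pre (X.delta c b) (mm R c))
    (h : mm R b = (X.delta c b)⁻¹ * mm R c) (hb : X.delta c b = X.delta c b')
    (h' : mm R b' = mm R b) : b = b' := by
  have h1 := gate_eq_of_between hk h
  have h2 := gate_eq_of_between (b := b') (hb ▸ hk) (by rw [h', h, hb])
  refine X.eq_of_between (E := X.gate R.1 c) hk hb ?_ ?_
  · rw [h1]; rw [← h1]; rw [show X.delta c (X.gate R.1 c) = mm R c from rfl, ← h, h1]; rfl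
  · rw [h2] ; rw [show X.delta b' (X.gate R.1 b') = mm R b' from rfl, h', ← h2, h1]; rfl

theorem mm_mul_inv_mem {J : Set B} (R : X.Res) {q q' : X.Chamber}
    (h : X.delta q q' ∈ cs.para J) : mm R q' * (mm R q)⁻¹ ∈ cs.para J := by
  induction hn : cs.length (X.delta q q') using Nat.strong_induction_on generalizing q with
  | _ n ih =>
  by_cases h1 : X.delta q q' = 1
  · have := (X.delta_eq_one_iff q q').1 h1
    subst this
    rw [mul_inv_cancel]; exact one_mem _
  obtain ⟨i, hi, hd⟩ := cs.exists_dn_of_mem_para h h1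
  obtain ⟨F, hF1, hF2⟩ := X.exists_between (pre_simple_iff.2 hd)
  rw [inv_simple] at hF2
  have h2 := ih (cs.length (X.delta F q')) (by rw [hF2, ← hn]; exact hd)
    (hF2 ▸ mul_mem (cs.simple_mem_para hi) h) rfl
  rcases mm_adj_pair R hF1 with h3 | h3
  · rw [h3, mul_inv_rev, inv_simple, ← mul_assoc] at h2
    exact (Subgroup.mul_mem_cancel_right _ (cs.simple_mem_para hi)).1 h2
  · rwa [h3] at h2

theorem lmin_of_gate {J : Set B} {q E : X.Chamber} (h : X.gate (X.residue J q) E = q) :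
    cs.LMin J (X.delta q E) := by
  obtain ⟨F, hF, h1⟩ := X.exists_gate J E q
  rw [X.gate_eq hF h1] at h
  subst h
  rw [RMin, ← X.delta_symm] at h1
  exact h1

theorem LMin.of_pre {J : Set B} {u v : W} (h : cs.Pre u v) (hv : cs.LMin J v) : cs.LMin J u :=
  fun i hi hd => hv i hi (pre_simple_iff.1 ((pre_simple_iff.2 hd).trans h))

theorem mem_projSet {J : Set B} {q : X.Chamber} {T : X.Res} :
    q ∈ X.projSet (X.residue J q) T.1 ↔ cs.LMin J (mm T q) := by
  constructor
  · rintro ⟨E, hE, h⟩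
    exact LMin.of_pre (mm_pre q hE) (lmin_of_gate h)
  · intro h
    refine ⟨X.gate T.1 q, gate_mem T q, ?_⟩
    refine X.gate_eq (X.self_mem_residue J q) ?_
    rw [RMin, ← X.delta_symm]
    exact h

theorem mem_projSet_res {σ T : X.Res} {q : X.Chamber} :
    q ∈ X.projSet σ.1 T.1 ↔ q ∈ σ.1 ∧ cs.LMin (typ σ) (mm T q) := by
  constructor
  · intro h
    have hq : q ∈ σ.1 := by
      obtain ⟨E, -, rfl⟩ := h
      exact gate_mem σ E
    rw [eq_residue hq] at h
    exact ⟨hq, mem_projSet.1 h⟩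
  · rintro ⟨hq, h⟩
    rw [eq_residue hq]
    exact mem_projSet.2 h

theorem projSet_eq {J : Set B} {q : X.Chamber} {T : X.Res} (h : cs.LMin J (mm T q)) :
    X.projSet (X.residue J q) T.1 =
      X.residue {t ∈ J | (mm T q)⁻¹ * cs.simple t * mm T q ∈ cs.para (typ T)} q := by
  ext q'
  constructor
  · intro hq'
    have hm : q' ∈ X.residue J q := by
      obtain ⟨E, -, rfl⟩ := hq'
      obtain ⟨F, hF, h1⟩ := X.exists_gate J E q
      rwa [X.gate_eq hF h1]
    rw [X.residue_eq hm, mem_projSet] at hq'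
    rw [mem_residue] at hm
    have h1 : mm T q' = mm T q := by
      have h2 := mm_mul_inv_mem T hm
      have h3 := h.length_mul' (x := mm T q' * (mm T q)⁻¹) h2 (by simpa using hq')
      rwa [mul_inv_eq_one] at h3
    rw [mem_residue]
    refine mem_para_of_conj hm h ?_
    have h3 : X.delta q (X.gate T.1 q') = X.delta q q' * mm T q' :=
      X.delta_add (by
        change _ = _ + cs.length (mm T q')
        exact hq'.length_mul _ hm)
    have h4 := delta_of_mem q (gate_mem T q')
    rw [mul_assoc, ← h1, ← h3, h4, h1, inv_mul_cancel_left]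
    exact delta_gate_mem q (gate_mem T q')
  · intro hq'
    rw [mem_residue] at hq'
    have hK := Set.sep_subset J fun t => (mm T q)⁻¹ * cs.simple t * mm T q ∈ cs.para (typ T)
    have hm : q' ∈ X.residue J q := cs.para_mono hK hq'
    rw [X.residue_eq hm, mem_projSet]
    suffices mm T q' = mm T q by rwa [this]
    clear hm h
    revert hq'
    generalize hw : mm T q = w
    intro hq'
    induction hn : cs.length (X.delta q q') using Nat.strong_induction_on generalizing q with
    | _ n ih =>
    by_cases h1 : X.delta q q' = 1
    · have := (X.delta_eq_one_iff q q').1 h1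
      subst this
      exact hw
    obtain ⟨i, hi, hd⟩ := cs.exists_dn_of_mem_para hq' h1
    obtain ⟨F, hF1, hF2⟩ := X.exists_between (pre_simple_iff.2 hd)
    rw [inv_simple] at hF2
    have hF3 : mm T F = w := by
      rw [← hw]; rw [← hw] at hi
      exact mm_adj_flat hF1 hi.2
    refine ih (cs.length (X.delta F q')) (by rw [hF2, ← hn]; exact hd) (q := F) ?_ hF3 ?_ rfl
    · rw [hF3, ← hw]; exact hK
    · rw [hF2]; exact mul_mem (cs.simple_mem_para hi) hq'

theorem projSet_nonempty (R : Set X.Chamber) (T : X.Res) : (X.projSet R T.1).Nonempty :=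
  (res_nonempty T).image _

theorem projRes_val (σ T : X.Res) : (X.projRes σ T).1 = X.projSet σ.1 T.1 := by
  refine Classical.epsilon_spec (p := fun U : X.Res => U.1 = X.projSet σ.1 T.1) ?_
  obtain ⟨q, hq⟩ := projSet_nonempty σ.1 T
  have h := mem_projSet_res.1 hq
  have h2 := projSet_eq h.2
  rw [← eq_residue h.1] at h2
  exact ⟨X.resOf _ ((typ_sph σ).mono (Set.sep_subset _ _)) q, h2.symm⟩

theorem res_ext {R T : X.Res} (h : R.1 = T.1) : R = T := Subtype.ext h

theorem sphType_singleton [Finite B] (i : B) : SphType cs {i} :=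
  finite_para (cs := cs) (w := cs.simple i) (by
    rintro j rfl
    unfold Dn
    simp)

variable (X) in
/-- The panel of type `i` containing `c`. -/
def pan [Finite B] (i : B) (c : X.Chamber) : X.Res := X.resOf {i} (sphType_singleton i) c

theorem mem_proj_pan [Finite B] {i : B} {c : X.Chamber} {T : X.Res} :
    c ∈ (X.projRes (X.pan i c) T).1 ↔ ¬ cs.Dn (cs.simple i) (mm T c) := by
  rw [projRes_val, show (X.pan i c).1 = X.residue {i} c from rfl, mem_projSet]
  simp [LMin]

theorem mem_residue_singleton {i : B} {c c' : X.Chamber} :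
    c' ∈ X.residue {i} c ↔ c = c' ∨ X.delta c c' = cs.simple i := by
  rw [mem_residue]
  constructor
  · intro h
    by_cases h1 : X.delta c c' = 1
    · exact Or.inl ((X.delta_eq_one_iff _ _).1 h1)
    · right
      obtain ⟨j, rfl, hd⟩ := cs.exists_dn_of_mem_para h h1
      have h2 := (cs.para {j}).mul_mem (cs.simple_mem_para (i := j) rfl) h
      by_contra h3
      have h4 : cs.simple j * X.delta c c' ≠ 1 := by
        rw [Ne, mul_eq_one_iff_eq_inv', inv_simple]; exact h3
      obtain ⟨j', rfl, hd'⟩ := cs.exists_dn_of_mem_para h2 h4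
      rw [dn_simple_mul] at hd'
      exact hd' hd
  · rintro (rfl | h)
    · rw [X.delta_self]; exact one_mem _
    · rw [h]; exact cs.simple_mem_para (by simp)

theorem pan_eq [Finite B] {i : B} {c c' : X.Chamber} (h : X.delta c c' = cs.simple i) :
    X.pan i c = X.pan i c' :=
  res_ext (X.residue_eq (mem_residue_singleton.2 (Or.inr h)))

section Convergence

variable {ξ : X.Res → X.Res} {R : ℕ → X.Res}

theorem ConvSeq.eventually (hR : X.ConvSeq ξ R) (σ : X.Res) :
    ∀ᶠ n in atTop, X.projRes σ (R n) = ξ σ := by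
  have h := (tendsto_pi_nhds.1 hR) σ
  rw [nhds_discrete, tendsto_pure] at h
  exact h

variable [Finite B]

theorem ConvSeq.dn_or (hR : X.ConvSeq ξ R) (c : X.Chamber) (i : B) :
    (∀ᶠ n in atTop, cs.Dn (cs.simple i) (mm (R n) c)) ∨
      ∀ᶠ n in atTop, ¬ cs.Dn (cs.simple i) (mm (R n) c) := by
  by_cases h : c ∈ (ξ (X.pan i c)).1
  · right
    filter_upwards [hR.eventually (X.pan i c)] with n hn
    rwa [← mem_proj_pan, hn]
  · left
    filter_upwards [hR.eventually (X.pan i c)] with n hn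
    rwa [← not_not (a := cs.Dn _ _), ← mem_proj_pan, hn]

theorem ConvSeq.exists_adj (hR : X.ConvSeq ξ R) {c : X.Chamber} {i : B}
    (h : ∀ᶠ n in atTop, cs.Dn (cs.simple i) (mm (R n) c)) :
    ∃ p, X.delta c p = cs.simple i ∧
      ∀ᶠ n in atTop, mm (R n) p = cs.simple i * mm (R n) c := by
  obtain ⟨N, hN, hN'⟩ := (h.and (hR.eventually (X.pan i c))).exists
  obtain ⟨p, hp, hp'⟩ := exists_lift (R N) c (pre_simple_iff.2 hN)
  rw [inv_simple] at hp'
  refine ⟨p, hp, ?_⟩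
  have h1 : p ∈ (ξ (X.pan i c)).1 := by
    rw [← hN', pan_eq hp, mem_proj_pan, hp', dn_simple_mul, not_not]
    exact hN
  filter_upwards [h, hR.eventually (X.pan i c)] with n h2 h3
  rw [← h3, pan_eq hp, mem_proj_pan] at h1
  refine (mm_adj_pair (R n) hp).resolve_right fun h4 => ?_
  rw [h4] at h1
  exact h1 h2

theorem ConvSeq.exists_lift (hR : X.ConvSeq ξ R) {c : X.Chamber} {k : W}
    (h : ∀ᶠ n in atTop, cs.Pre k (mm (R n) c)) :
    ∃ b, X.delta c b = k ∧ ∀ᶠ n in atTop, mm (R n) b = k⁻¹ * mm (R n) c := by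
  induction hn : cs.length k using Nat.strong_induction_on generalizing k c with
  | _ n ih =>
  by_cases h1 : k = 1
  · subst h1
    exact ⟨c, X.delta_self c, by simp⟩
  obtain ⟨i, hi⟩ := cs.exists_leftDescent_of_ne_one h1
  have hi' : cs.Pre (cs.simple i) k := pre_simple_iff.2 hi
  obtain ⟨p, hp, hp'⟩ := hR.exists_adj (c := c) (i := i) (by
    filter_upwards [h] with n h
    exact pre_simple_iff.1 (hi'.trans h))
  obtain ⟨b, hb, hb'⟩ := ih (cs.length (cs.simple i * k)) (hn ▸ hi) (c := p) (k := cs.simple i * k)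
    (by
      filter_upwards [h, hp'] with n h h2
      rw [h2]
      have := (hi'.inv_mul h).2
      rwa [inv_simple] at this) rfl
  refine ⟨b, ?_, ?_⟩
  · have h2 : X.delta c p * X.delta p b = k := by rw [hp, hb]; simp
    rw [← h2]
    refine X.delta_add ?_
    rw [h2, hp, hb, length_simple]
    have := (cs.dn_simple_iff i k).1 hi
    omega
  · filter_upwards [hp', hb'] with n h2 h3
    rw [h3, h2, mul_inv_rev, inv_simple]
    simp [mul_assoc]

end Convergence

end Bldg

namespace Bldg

open CoxeterSystem

variable {cs : CoxeterSystem M W} {X : Bldg cs}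

theorem length_fold_le (C D E : X.Chamber) :
    cs.length ((X.delta C D)⁻¹ * X.delta C E) ≤ cs.length (X.delta D E) := by
  induction hn : cs.length (X.delta D E) using Nat.strong_induction_on generalizing E with
  | _ n ih =>
  by_cases h1 : X.delta D E = 1
  · have := (X.delta_eq_one_iff D E).1 h1
    subst this
    simp
  obtain ⟨i, hi⟩ := cs.exists_rightDescent_of_ne_one h1
  obtain ⟨F, hF1, hF2⟩ := X.exists_delta D E i
  rw [isRightDescent_iff, ← hF2] at hi
  have h3 := ih _ (by omega) F rfl
  rcases X.delta_mem_pair C F E i (X.delta_simple_symm hF1) with h4 | h4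
  · rw [h4, ← mul_assoc]
    have := cs.length_mul_simple ((X.delta C D)⁻¹ * X.delta C F) i
    omega
  · rw [h4]; omega

theorem delta_of_same_side {c₀ E c₁ c : X.Chamber} {i : B} (hE : X.delta c₀ E = cs.simple i)
    (h : X.delta c₁ c = (X.delta c₀ c₁)⁻¹ * X.delta c₀ c)
    (h₁ : X.delta E c₁ = cs.simple i * X.delta c₀ c₁)
    (hd₁ : cs.Dn (cs.simple i) (X.delta c₀ c₁)) (hd : cs.Dn (cs.simple i) (X.delta c₀ c)) :
    X.delta E c = cs.simple i * X.delta c₀ c := by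
  induction hn : cs.length (X.delta c₁ c) using Nat.strong_induction_on generalizing c₁ with
  | _ n ih =>
  by_cases h1 : X.delta c₁ c = 1
  · have := (X.delta_eq_one_iff c₁ c).1 h1
    subst this
    exact h₁
  obtain ⟨j, hj⟩ := cs.exists_leftDescent_of_ne_one h1
  obtain ⟨a, ha1, ha2⟩ := X.exists_between (pre_simple_iff.2 hj)
  rw [inv_simple] at ha2
  have hj' := (cs.dn_simple_iff j _).1 hj
  have ha : X.delta c₀ a = X.delta c₀ c₁ * cs.simple j := by
    refine (X.delta_mem_pair c₀ c₁ a j ha1).resolve_right fun h2 => ?_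
    have h3 := length_fold_le c₀ a c
    rw [h2, ← h, ha2] at h3
    omega
  have hr : cs.IsReflection ((X.delta c₀ c₁)⁻¹ * cs.simple i * X.delta c₀ c₁) := by
    simpa using (cs.isReflection_simple i).conj (X.delta c₀ c₁)⁻¹
  have hda : cs.Dn (cs.simple i) (X.delta c₀ a) := by
    rw [ha, dn_mul cs (cs.isReflection_simple i)]
    have h2 : X.delta c₀ c = X.delta c₀ c₁ * X.delta c₁ c := by rw [h, mul_inv_cancel_left]
    rw [h2, dn_mul cs (cs.isReflection_simple i)] at hd
    have h3 : cs.Dn ((X.delta c₀ c₁)⁻¹ * cs.simple i * X.delta c₀ c₁) (cs.simple j) →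
        cs.Dn ((X.delta c₀ c₁)⁻¹ * cs.simple i * X.delta c₀ c₁) (X.delta c₁ c) := by
      intro h4
      have h5 : (X.delta c₀ c₁)⁻¹ * cs.simple i * X.delta c₀ c₁ = cs.simple j := by
        unfold Dn at h4
        rw [length_simple, Nat.lt_one_iff, length_eq_zero_iff, mul_eq_one_iff_eq_inv,
          inv_simple] at h4
        exact h4
      rw [h5]
      exact hj
    tauto
  have hEa : X.delta E a = cs.simple i * X.delta c₀ a := by
    refine (X.delta_left_pair (X.delta_simple_symm hE) a).resolve_right fun h2 => ?_
    rcases X.delta_mem_pair E c₁ a j ha1 with h3 | h3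
    · rw [h3, h₁, ha, mul_assoc] at h2
      have := cs.length_simple_mul_ne (X.delta c₀ c₁ * cs.simple j) i
      rw [h2] at this
      exact this rfl
    · rw [← h2, h3, h₁, dn_simple_mul] at hda
      exact hda hd₁
  refine ih (cs.length (X.delta a c)) (by rw [ha2]; omega) (c₁ := a) ?_ hEa hda rfl
  rw [ha2, ha, h]
  simp [mul_assoc]

/-- A set of pairs describing a partial isometry from the Coxeter complex to the building. -/
def IsPartialIso (S : Set (W × X.Chamber)) : Prop :=
  ∀ p ∈ S, ∀ q ∈ S, X.delta p.2 q.2 = p.1⁻¹ * q.1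

theorem IsPartialIso.exists_adj {S : Set (W × X.Chamber)} (hS : IsPartialIso S) {w : W}
    {c₀ : X.Chamber} (h₀ : (w, c₀) ∈ S) (i : B) :
    ∃ E, IsPartialIso (insert (w * cs.simple i, E) S) := by
  suffices H : ∃ E, ∀ p ∈ S, X.delta E p.2 = (w * cs.simple i)⁻¹ * p.1 by
    obtain ⟨E, hE⟩ := H
    refine ⟨E, ?_⟩
    rintro p (rfl | hp) q (rfl | hq)
    · simp [X.delta_self]
    · exact hE q hq
    · rw [X.delta_symm, hE p hp]; simp [mul_assoc]
    · exact hS p hp q hq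
  have hc : ∀ p ∈ S, X.delta c₀ p.2 = w⁻¹ * p.1 := fun p hp => hS _ h₀ p hp
  have e : ∀ p : W × X.Chamber, (w * cs.simple i)⁻¹ * p.1 = cs.simple i * (w⁻¹ * p.1) := by
    intro p; simp [mul_assoc]
  by_cases hA : ∃ p ∈ S, cs.Dn (cs.simple i) (w⁻¹ * p.1)
  · obtain ⟨p, hp, hd⟩ := hA
    rw [← hc p hp] at hd
    obtain ⟨E, hE1, hE2⟩ := X.exists_between (pre_simple_iff.2 hd)
    rw [inv_simple] at hE2
    refine ⟨E, fun q hq => ?_⟩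
    rw [e, ← hc q hq]
    by_cases hdq : cs.Dn (cs.simple i) (X.delta c₀ q.2)
    · refine delta_of_same_side hE1 ?_ hE2 hd hdq
      rw [hS p hp q hq, hc p hp, hc q hq]
      group
    · exact X.delta_left_of_not_dn (X.delta_simple_symm hE1) hdq
  · obtain ⟨E, hE⟩ := X.exists_delta_eq c₀ (cs.simple i)
    refine ⟨E, fun q hq => ?_⟩
    rw [e, ← hc q hq]
    refine X.delta_left_of_not_dn (X.delta_simple_symm hE) fun h => hA ⟨q, hq, ?_⟩
    rwa [← hc q hq]

/-- Partial isometries extend to apartments. -/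
theorem IsPartialIso.exists_apartMap {S : Set (W × X.Chamber)} (hS : IsPartialIso S)
    (hne : S.Nonempty) : ∃ α : W → X.Chamber, X.IsApartMap α ∧ ∀ p ∈ S, α p.1 = p.2 := by
  obtain ⟨T, hST, hT⟩ := zorn_subset_nonempty {T : Set (W × X.Chamber) | IsPartialIso T} (by
    intro c hc hch _
    refine ⟨⋃₀ c, ?_, fun s hs => Set.subset_sUnion_of_mem hs⟩
    rintro p ⟨s, hs, hp⟩ q ⟨t, ht, hq⟩
    rcases hch.total hs ht with h | h
    · exact hc ht p (h hp) q hq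
    · exact hc hs p hp q (h hq)) S hS
  have step : ∀ w c (i : B), (w, c) ∈ T → ∃ c', (w * cs.simple i, c') ∈ T := by
    intro w c i h
    obtain ⟨E, hE⟩ := hT.prop.exists_adj h i
    exact ⟨E, hT.le_of_ge hE (Set.subset_insert _ _) (Set.mem_insert _ _)⟩
  obtain ⟨⟨w₀, c₀⟩, h₀⟩ := hne.mono hST
  have all : ∀ w, ∃ c, (w₀ * w, c) ∈ T := by
    intro w
    induction w using cs.simple_induction_right with
    | one => exact ⟨c₀, by simpa using h₀⟩
    | mul_simple_right w i ih =>
      obtain ⟨c, hc⟩ := ih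
      obtain ⟨c', hc'⟩ := step _ c i hc
      exact ⟨c', by rwa [mul_assoc] at hc'⟩
  have all' : ∀ w, ∃ c, (w, c) ∈ T := fun w => by simpa using all (w₀⁻¹ * w)
  choose α hα using all'
  have hiso : ∀ v w, X.delta (α v) (α w) = v⁻¹ * w := fun v w => hT.prop _ (hα v) _ (hα w)
  refine ⟨α, ⟨fun v w h => ?_, hiso⟩, fun p hp => ?_⟩
  · have := hiso v w
    rw [h, X.delta_self, eq_comm, inv_mul_eq_one] at this
    exact this
  · have := hT.prop _ (hα p.1) p (hST hp)
    rw [inv_mul_cancel, delta_eq_one_iff] at this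
    exact this

theorem exists_apartMap_one (C : X.Chamber) : ∃ α : W → X.Chamber, X.IsApartMap α ∧ α 1 = C := by
  obtain ⟨α, h1, h2⟩ := IsPartialIso.exists_apartMap (X := X) (S := {((1 : W), C)})
    (by rintro p rfl q rfl; simp [X.delta_self]) ⟨_, rfl⟩
  exact ⟨α, h1, h2 _ rfl⟩

section Group

variable {G : Subgroup X.Aut}

theorem delta_smul (g : X.Aut) (C D : X.Chamber) : X.delta (g • C) (g • D) = X.delta C D :=
  g.2 C D

theorem delta_smul' (g : G) (C D : X.Chamber) : X.delta (g • C) (g • D) = X.delta C D :=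
  delta_smul (g : X.Aut) C D

theorem exists_smul_apartMap (hst : X.StronglyTransitive G) {α α' : W → X.Chamber}
    (hα : X.IsApartMap α) (hα' : X.IsApartMap α') : ∃ g : G, ∀ w, g • α w = α' w := by
  obtain ⟨g, hg, h1, h2⟩ := hst (α 1) (α' 1) _ _ ⟨α, hα, rfl⟩ ⟨1, rfl⟩ ⟨α', hα', rfl⟩ ⟨1, rfl⟩
  refine ⟨⟨g, hg⟩, fun w => ?_⟩
  have : g • α w ∈ Set.range α' := h2 ▸ Set.mem_image_of_mem _ ⟨w, rfl⟩
  obtain ⟨w', hw'⟩ := this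
  change g • α w = α' w
  have h3 := delta_smul g (α 1) (α w)
  rw [← hw', show g • α 1 = α' 1 from h1, hα.2, hα'.2] at h3
  simp only [inv_one, one_mul] at h3
  rw [← hw', h3]

theorem exists_smul_pair (hst : X.StronglyTransitive G) {C D C' D' : X.Chamber}
    (h : X.delta C D = X.delta C' D') : ∃ g : G, g • C = C' ∧ g • D = D' := by
  have key : ∀ C D : X.Chamber, ∃ α : W → X.Chamber, X.IsApartMap α ∧ α 1 = C ∧
      α (X.delta C D) = D := by
    intro C D
    obtain ⟨α, h1, h2⟩ := IsPartialIso.exists_apartMap (X := X)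
      (S := {((1 : W), C), (X.delta C D, D)})
      (by
        rintro p (rfl | rfl) q (rfl | rfl)
        · simp [X.delta_self]
        · simp
        · rw [X.delta_symm]; simp
        · simp [X.delta_self]) ⟨_, Or.inl rfl⟩
    exact ⟨α, h1, h2 _ (Or.inl rfl), h2 _ (Or.inr rfl)⟩
  obtain ⟨α, hα, h1, h2⟩ := key C D
  obtain ⟨α', hα', h1', h2'⟩ := key C' D'
  obtain ⟨g, hg⟩ := exists_smul_apartMap hst hα hα'
  refine ⟨g, by rw [← h1, hg, h1'], ?_⟩
  rw [← h2, hg, h, h2']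

theorem smul_residue (g : X.Aut) (I : Set B) (C : X.Chamber) :
    (fun c => g • c) '' X.residue I C = X.residue I (g • C) := by
  ext D
  constructor
  · rintro ⟨E, hE, rfl⟩
    rw [mem_residue, delta_smul]; exact hE
  · intro hD
    refine ⟨g⁻¹ • D, ?_, smul_inv_smul g D⟩
    rw [mem_residue, ← delta_smul g, smul_inv_smul]
    exact hD

theorem actRes_val (g : X.Aut) (R : X.Res) : (X.actRes g R).1 = (fun c => g • c) '' R.1 := by
  refine Classical.epsilon_spec (p := fun T : X.Res => T.1 = (fun c => g • c) '' R.1) ?_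
  obtain ⟨C, hC⟩ := res_nonempty R
  refine ⟨X.resOf (typ R) (typ_sph R) (g • C), ?_⟩
  rw [eq_residue hC, smul_residue]
  rfl

theorem mem_actRes {g : X.Aut} {R : X.Res} {c : X.Chamber} :
    g • c ∈ (X.actRes g R).1 ↔ c ∈ R.1 := by
  rw [actRes_val]
  exact (MulAction.injective g).mem_set_image

theorem actRes_one (R : X.Res) : X.actRes 1 R = R := res_ext (by simp [actRes_val])

theorem actRes_mul (g h : X.Aut) (R : X.Res) : X.actRes (g * h) R = X.actRes g (X.actRes h R) :=
  res_ext (by simp [actRes_val, Set.image_image, mul_smul])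

theorem actRes_inv_act (g : X.Aut) (R : X.Res) : X.actRes g⁻¹ (X.actRes g R) = R := by
  rw [← actRes_mul, inv_mul_cancel, actRes_one]

theorem actRes_act_inv (g : X.Aut) (R : X.Res) : X.actRes g (X.actRes g⁻¹ R) = R := by
  rw [← actRes_mul, mul_inv_cancel, actRes_one]

theorem gate_actRes (g : X.Aut) (R : X.Res) (c : X.Chamber) :
    X.gate (X.actRes g R).1 (g • c) = g • X.gate R.1 c := by
  have h1 : (X.actRes g R).1 = X.residue (typ R) (g • X.gate R.1 c) := by
    rw [actRes_val, ← smul_residue, ← eq_residue (gate_mem R c)]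
  rw [h1]
  refine X.gate_eq (X.self_mem_residue _ _) ?_
  rw [delta_smul]
  exact mm_rmin R c

theorem mm_actRes (g : X.Aut) (R : X.Res) (c : X.Chamber) : mm (X.actRes g R) (g • c) = mm R c := by
  unfold mm
  rw [gate_actRes, delta_smul]

theorem projRes_actRes (g : X.Aut) (σ T : X.Res) :
    X.projRes (X.actRes g σ) (X.actRes g T) = X.actRes g (X.projRes σ T) := by
  apply res_ext
  rw [projRes_val, actRes_val g (X.projRes σ T), projRes_val]
  unfold projSet
  rw [actRes_val g T, Set.image_image, Set.image_image]
  exact Set.image_congr fun c _ => gate_actRes g σ c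

theorem actRes_eq_of_mem {g : X.Aut} {R : X.Res} {c : X.Chamber} (hc : c ∈ R.1)
    (hgc : g • c ∈ R.1) : X.actRes g R = R := by
  apply res_ext
  rw [actRes_val, eq_residue hc, smul_residue, ← X.residue_eq]
  rw [← eq_residue hc]
  exact hgc

theorem smul_mem_of_actRes {g : X.Aut} {R : X.Res} {c : X.Chamber} (h : X.actRes g R = R)
    (hc : c ∈ R.1) : g • c ∈ R.1 := by
  rw [← h]; exact mem_actRes.2 hc

theorem convexResSet_fixed (g : X.Aut) : X.ConvexResSet {Q | X.actRes g Q = Q} := by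
  constructor
  · intro R₁ R₂ h h2
    obtain ⟨c, hc⟩ := res_nonempty R₂
    exact actRes_eq_of_mem (h hc) (h (smul_mem_of_actRes h2 hc))
  · intro R₁ h1 R₂ h2
    change X.actRes g _ = _ at h1 h2 ⊢
    rw [← projRes_actRes, h1, h2]

theorem actRes_eq_of_mem_conv2 {g : X.Aut} {R T Q : X.Res} (h1 : X.actRes g R = R)
    (h2 : X.actRes g T = T) (hQ : Q ∈ X.conv2 R T) : X.actRes g Q = Q :=
  hQ {S | X.actRes g S = S} ⟨convexResSet_fixed g, by rintro S (rfl | rfl) <;> assumption⟩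

theorem mm_smul_of_actRes {g : X.Aut} {R : X.Res} (h : X.actRes g R = R) (c : X.Chamber) :
    mm R (g • c) = mm R c := by
  conv_lhs => rw [← h]
  exact mm_actRes g R c

end Group

section LocallyFinite

theorem finite_sphere (hlf : X.LocallyFinite)
    (c : X.Chamber) (w : W) : {d | X.delta c d = w}.Finite := by
  have := hlf.1
  induction w using cs.simple_induction_right with
  | one =>
    refine (Set.finite_singleton c).subset fun d hd => ?_
    exact ((X.delta_eq_one_iff c d).1 hd).symm
  | mul_simple_right w i ih =>
    refine (ih.biUnion fun d _ => hlf.2 (X.residue {i} d) ⟨i, d, rfl⟩).subset fun e he => ?_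
    obtain ⟨F, hF1, hF2⟩ := X.exists_delta c e i
    rw [show X.delta c e = _ from he, simple_mul_simple_cancel_right] at hF2
    exact Set.mem_biUnion hF2 (mem_residue_singleton.2 (Or.inr (X.delta_simple_symm hF1)))

theorem countable_chamber (hlf : X.LocallyFinite) : Countable X.Chamber := by
  have := hlf.1
  have : Countable B := Finite.to_countable
  have : Countable W := cs.wordProd_surjective.countable
  obtain ⟨c⟩ := X.chamber_nonempty
  rw [← Set.countable_univ_iff]
  refine (Set.countable_iUnion fun w => (finite_sphere hlf c w).countable).mono fun d _ =>
    Set.mem_iUnion.2 ⟨X.delta c d, rfl⟩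

theorem finite_res (hlf : X.LocallyFinite) (R : X.Res) : R.1.Finite := by
  obtain ⟨c, hc⟩ := res_nonempty R
  rw [eq_residue hc]
  refine ((typ_sph R).biUnion fun w _ => finite_sphere hlf c w).subset fun d hd => ?_
  exact Set.mem_biUnion hd rfl

theorem countable_res (hlf : X.LocallyFinite) : Countable X.Res := by
  have := hlf.1
  have := countable_chamber hlf
  have : Function.Injective fun R : X.Res =>
      ((typ R, (res_nonempty R).some) : Set B × X.Chamber) := by
    intro R T h
    apply res_ext
    simp only [Prod.mk.injEq] at h
    rw [eq_residue (res_nonempty R).some_mem, eq_residue (res_nonempty T).some_mem, h.1, h.2]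
  exact this.countable

end LocallyFinite

end Bldg

namespace Bldg

open CoxeterSystem

variable {cs : CoxeterSystem M W} {X : Bldg cs} {G : Subgroup X.Aut}

theorem isInducing_smul (G : Subgroup X.Aut) :
    IsInducing fun (g : G) (c : X.Chamber) => g • c :=
  (IsInducing.induced fun g : X.Aut => ((g : Equiv.Perm X.Chamber) : X.Chamber → X.Chamber)).comp
    IsInducing.subtypeVal

theorem smul_injective (G : Subgroup X.Aut) :
    Function.Injective fun (g : G) (c : X.Chamber) => g • c := fun _ _ e =>
  Subtype.ext (Subtype.ext (Equiv.ext fun c => congrFun e c))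

theorem tendsto_iff_eventually_smul {ι : Type*} {l : Filter ι} {g : ι → G} {a : G} :
    Tendsto g l (𝓝 a) ↔ ∀ c : X.Chamber, ∀ᶠ n in l, g n • c = a • c := by
  rw [(isInducing_smul G).tendsto_nhds_iff, tendsto_pi_nhds]
  simp only [nhds_discrete, tendsto_pure, Function.comp]

instance : T2Space G :=
  T2Space.of_injective_continuous (smul_injective G) (isInducing_smul G).continuous

theorem firstCountable_group (hlf : X.LocallyFinite) (G : Subgroup X.Aut) :
    FirstCountableTopology G := by
  have := countable_chamber hlf
  exact (isInducing_smul G).firstCountableTopology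

theorem isOpen_agree (g : G) {Φ : Set X.Chamber} (hΦ : Φ.Finite) :
    IsOpen {h : G | ∀ c ∈ Φ, h • c = g • c} := by
  have : {h : G | ∀ c ∈ Φ, h • c = g • c} = ⋂ c ∈ Φ, {h : G | h • c = g • c} := by
    ext; simp
  rw [this]
  refine hΦ.isOpen_biInter fun c _ => ?_
  have hc : Continuous fun h : G => h • c :=
    (continuous_apply c).comp (isInducing_smul G).continuous
  exact (isOpen_discrete ({g • c} : Set X.Chamber)).preimage hc

theorem exists_agree_subset {U : Set G} (hU : IsOpen U) {g : G} (hg : g ∈ U) :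
    ∃ Φ : Set X.Chamber, Φ.Finite ∧ {h : G | ∀ c ∈ Φ, h • c = g • c} ⊆ U := by
  have h1 := hU.mem_nhds hg
  rw [(isInducing_smul G).nhds_eq_comap, nhds_pi, mem_comap] at h1
  obtain ⟨t, ht, htU⟩ := h1
  rw [Filter.mem_pi] at ht
  obtain ⟨I, hI, s, hs, hst⟩ := ht
  refine ⟨I, hI, fun (h : G) (hh : ∀ c ∈ I, h • c = g • c) => htU (hst fun c hc => ?_)⟩
  have := mem_of_mem_nhds (hs c)
  rw [← hh c hc] at this
  exact this

theorem isCompact_of_finite_orbit (hlf : X.LocallyFinite) (hGc : IsClosed (G : Set X.Aut))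
    (x : X.Chamber) {F : Set X.Chamber} (hF : F.Finite) : IsCompact {g : G | g • x ∈ F} := by
  rw [isCompact_iff_ultrafilter_le_nhds]
  intro U hU
  rw [le_principal_iff] at hU
  have hcov : ∀ c : X.Chamber, ∃ d, ∀ᶠ g : G in (U : Filter G), g • c = d := by
    intro c
    have hfin : (⋃ y ∈ F, {d | X.delta y d = X.delta x c}).Finite :=
      hF.biUnion fun y _ => finite_sphere hlf y _
    have : ∀ᶠ g : G in (U : Filter G), ∃ d ∈ (⋃ y ∈ F, {d | X.delta y d = X.delta x c}),
        g • c = d := by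
      filter_upwards [hU] with g hg
      exact ⟨_, Set.mem_biUnion hg (delta_smul' g x c), rfl⟩
    rw [Ultrafilter.eventually_exists_mem_iff hfin] at this
    obtain ⟨d, _, hd⟩ := this
    exact ⟨d, hd⟩
  have hcov' : ∀ c : X.Chamber, ∃ d, ∀ᶠ g : G in (U : Filter G), g⁻¹ • c = d := by
    intro c
    have hfin : (⋃ y ∈ F, {d | X.delta x d = X.delta y c}).Finite :=
      hF.biUnion fun y _ => finite_sphere hlf x _
    have : ∀ᶠ g : G in (U : Filter G), ∃ d ∈ (⋃ y ∈ F, {d | X.delta x d = X.delta y c}),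
        g⁻¹ • c = d := by
      filter_upwards [hU] with g hg
      refine ⟨_, Set.mem_biUnion (x := g • x) hg ?_, rfl⟩
      have := delta_smul' g x (g⁻¹ • c)
      rw [smul_inv_smul] at this
      exact this.symm
    rw [Ultrafilter.eventually_exists_mem_iff hfin] at this
    obtain ⟨d, _, hd⟩ := this
    exact ⟨d, hd⟩
  choose f hf using hcov
  choose f' hf' using hcov'
  have e1 : ∀ c, f (f' c) = c := fun c => by
    obtain ⟨g, h1, h2⟩ := ((hf' c).and (hf (f' c))).exists
    rw [← h2, ← h1, smul_inv_smul]
  have e2 : ∀ c, f' (f c) = c := fun c => by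
    obtain ⟨g, h1, h2⟩ := ((hf' (f c)).and (hf c)).exists
    rw [← h1, ← h2, inv_smul_smul]
  let a : X.Aut := ⟨⟨f, f', e2, e1⟩, fun C D => by
    obtain ⟨g, h1, h2⟩ := ((hf C).and (hf D)).exists
    change X.delta (f C) (f D) = _
    rw [← h1, ← h2, delta_smul']⟩
  have ht : Tendsto (fun g : G => (g : X.Aut)) U (𝓝 a) := by
    rw [(IsInducing.induced
      fun g : X.Aut => ((g : Equiv.Perm X.Chamber) : X.Chamber → X.Chamber)).tendsto_nhds_iff,
      tendsto_pi_nhds]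
    intro c
    simp only [nhds_discrete, tendsto_pure, Function.comp]
    exact hf c
  have haG : a ∈ G := hGc.mem_of_tendsto ht (Eventually.of_forall fun g => g.2)
  refine ⟨⟨a, haG⟩, ?_, ?_⟩
  · obtain ⟨g, h1, h2⟩ := ((hf x).and hU).exists
    change f x ∈ F
    rw [← h1]
    exact h2
  · change Tendsto id (U : Filter G) (𝓝 _)
    rw [tendsto_iff_eventually_smul]
    exact hf

theorem isCompact_agree (hlf : X.LocallyFinite) (hGc : IsClosed (G : Set X.Aut)) (g : G)
    {Φ : Set X.Chamber} (hne : Φ.Nonempty) :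
    IsCompact {h : G | ∀ c ∈ Φ, h • c = g • c} := by
  obtain ⟨x, hx⟩ := hne
  have hcl : IsClosed {h : G | ∀ c ∈ Φ, h • c = g • c} := by
    have : {h : G | ∀ c ∈ Φ, h • c = g • c} = ⋂ c ∈ Φ, {h : G | h • c = g • c} := by
      ext; simp
    rw [this]
    refine isClosed_biInter fun c _ => ?_
    have hc : Continuous fun h : G => h • c :=
      (continuous_apply c).comp (isInducing_smul G).continuous
    exact (isClosed_discrete ({g • c} : Set X.Chamber)).preimage hc
  exact (isCompact_of_finite_orbit hlf hGc x (Set.finite_singleton (g • x))).of_isClosed_subset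
    hcl fun h hh => hh x hx

theorem exists_subseq_tendsto (hlf : X.LocallyFinite) (hGc : IsClosed (G : Set X.Aut))
    {x y : X.Chamber} {g : ℕ → G} (hg : ∀ n, g n • x = y) :
    ∃ (a : G) (φ : ℕ → ℕ), StrictMono φ ∧ ∀ c : X.Chamber, ∀ᶠ n in atTop, g (φ n) • c = a • c := by
  have := firstCountable_group hlf G
  obtain ⟨a, _, φ, hφ, h⟩ := (isCompact_of_finite_orbit hlf hGc x
    (Set.finite_singleton y)).tendsto_subseq (x := g) hg
  exact ⟨a, φ, hφ, tendsto_iff_eventually_smul.1 h⟩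

theorem inv_smul_eq_of_smul_inv_smul {g a : G} {c : X.Chamber} (h : g • (a⁻¹ • c) = a • (a⁻¹ • c)) :
    g⁻¹ • c = a⁻¹ • c := by
  rw [inv_smul_eq_iff, h, smul_inv_smul]

/-- The elements of `G` that asymptotically preserve the distance to the residues `R n`. -/
def asymStab (G : Subgroup X.Aut) (R : ℕ → X.Res) : Set G :=
  {g | ∀ c, ∀ᶠ n in atTop, mm (R n) (g • c) = mm (R n) c}

theorem apart_mm_mem {T : X.Res} {α : W → X.Chamber} (hα : X.IsApartMap α) {w : W}
    (hw : α w ∈ T.1) : α (mm T (α 1)) ∈ T.1 := by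
  have h1 := delta_of_mem (α 1) hw
  rw [hα.2, inv_one, one_mul] at h1
  have h2 : w⁻¹ * mm T (α 1) = (X.delta (X.gate T.1 (α 1)) (α w))⁻¹ := by
    conv_lhs => rw [h1]
    simp
  rw [mem_iff hw, hα.2, h2]
  exact inv_mem (delta_gate_mem _ hw)

theorem delta_gate_of_mm_eq {T : X.Res} {α : W → X.Chamber} (hα : X.IsApartMap α) {w : W}
    (hw : α w ∈ T.1) {g : G} {m : ℕ}
    (hg : ∀ u, cs.length u ≤ m → mm T (g • α u) = mm T (α u)) {u : W} (hu : cs.length u ≤ m) :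
    X.delta (g • α u) (X.gate T.1 (g • α 1)) = u⁻¹ * mm T (α 1) := by
  have hv := apart_mm_mem hα hw
  set v := mm T (α 1) with hv'
  have hrv : cs.RMin (typ T) v := mm_rmin T (α 1)
  induction hn : cs.length u using Nat.strong_induction_on generalizing u with
  | _ n ih =>
  by_cases h1 : u = 1
  · subst h1
    have := hg 1 (by simp)
    rw [inv_one, one_mul, hv', ← this]
    rfl
  obtain ⟨i, hi⟩ := cs.exists_rightDescent_of_ne_one h1
  rw [isRightDescent_iff] at hi
  obtain ⟨u', rfl⟩ : ∃ u', u = u' * cs.simple i := ⟨u * cs.simple i, by simp⟩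
  rw [simple_mul_simple_cancel_right] at hi
  have h2 := ih (cs.length u') (by omega) (u := u') (by omega) rfl
  have h3 : X.delta (g • α (u' * cs.simple i)) (g • α u') = cs.simple i := by
    rw [delta_smul', hα.2]; simp
  have h4 := delta_of_mem (g • α (u' * cs.simple i)) (gate_mem T (g • α 1))
  have h5 := delta_of_mem (α (u' * cs.simple i)) hv
  rw [hα.2] at h5
  rw [hg _ hu] at h4
  set E := X.gate T.1 (g • α 1)
  have h6 : ((u' * cs.simple i)⁻¹ * v)⁻¹ * X.delta (g • α (u' * cs.simple i)) E
      ∈ cs.para (typ T) := by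
    rw [h4, h5, mul_inv_rev, mul_assoc, inv_mul_cancel_left]
    exact mul_mem (inv_mem (delta_gate_mem _ hv)) (delta_gate_mem _ (gate_mem T _))
  have hd : ¬ cs.Dn (cs.simple i) (X.delta (g • α u') E) ∨
      X.delta (g • α (u' * cs.simple i)) E = cs.simple i * X.delta (g • α u') E := by
    by_contra! hcon
    obtain ⟨hc1, hc2⟩ := hcon
    have h7 := (X.delta_left_pair h3 E).resolve_left hc2
    rw [h7, h2] at h6
    rw [h2] at hc1
    have hr : cs.IsReflection (u' * cs.simple i * u'⁻¹) := (cs.isReflection_simple i).conj u'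
    have h8 : ¬ cs.Dn (u' * cs.simple i * u'⁻¹) v := by
      refine hrv.not_dn ?_
      convert h6 using 1
      simp [mul_assoc]
    have h9 := dn_mul cs hr u' (u'⁻¹ * v)
    rw [mul_inv_cancel_left] at h9
    have h10 : u'⁻¹ * (u' * cs.simple i * u'⁻¹) * u' = cs.simple i := by group
    rw [h10] at h9
    have h11 : ¬ cs.Dn (u' * cs.simple i * u'⁻¹) u' := by
      unfold Dn
      rw [inv_mul_cancel_right]
      omega
    tauto
  have h12 : X.delta (g • α (u' * cs.simple i)) E = cs.simple i * X.delta (g • α u') E :=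
    hd.elim (fun h => X.delta_left_of_not_dn h3 h) id
  rw [h12, h2]
  simp [mul_assoc]

theorem exists_actRes_of_mm_eq (hst : X.StronglyTransitive G) {T : X.Res} {α : W → X.Chamber}
    (hα : X.IsApartMap α) {w : W} (hw : α w ∈ T.1) {g : G} {m : ℕ}
    (hg : ∀ u, cs.length u ≤ m → mm T (g • α u) = mm T (α u)) :
    ∃ h : G, X.actRes h T = T ∧ ∀ u, cs.length u ≤ m → h • α u = g • α u := by
  obtain ⟨β, hβ, h2⟩ := IsPartialIso.exists_apartMap (X := X)
    (S := insert (mm T (α 1), X.gate T.1 (g • α 1))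
      ((fun u => (u, g • α u)) '' {u | cs.length u ≤ m})) (by
        rintro p (rfl | ⟨u, hu, rfl⟩) q (rfl | ⟨u', hu', rfl⟩)
        · simp [X.delta_self]
        · rw [X.delta_symm, delta_gate_of_mm_eq hα hw hg hu']; simp
        · exact delta_gate_of_mm_eq hα hw hg hu
        · simp only []
          rw [delta_smul', hα.2]) (Set.insert_nonempty _ _)
  obtain ⟨h, hh⟩ := exists_smul_apartMap hst hα hβ
  refine ⟨h, actRes_eq_of_mem (apart_mm_mem hα hw) ?_, fun u hu => ?_⟩
  · change h • α _ ∈ T.1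
    rw [hh, h2 _ (Set.mem_insert _ _)]
    exact gate_mem _ _
  · rw [hh]
    exact h2 _ (Set.mem_insert_of_mem _ ⟨u, hu, rfl⟩)

theorem actRes_coe_mul (g h : G) (R : X.Res) :
    X.actRes ((g * h : G) : X.Aut) R = X.actRes g (X.actRes h R) := actRes_mul _ _ R

theorem mm_actRes_left (g : G) (R : X.Res) (c : X.Chamber) :
    mm (X.actRes g R) c = mm R (g⁻¹ • c) := by
  conv_lhs => rw [← smul_inv_smul g c]
  exact mm_actRes (g : X.Aut) R _

/-- Elements preserving distances asymptotically are limits of elements of the stabilisers. -/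
theorem eventually_exists_actRes (hlf : X.LocallyFinite) (hGc : IsClosed (G : Set X.Aut))
    (hst : X.StronglyTransitive G) {R : ℕ → X.Res} {g : G} (hg : g ∈ asymStab G R)
    {Φ : Set X.Chamber} (hΦ : Φ.Finite) :
    ∀ᶠ n in atTop, ∃ h : G, X.actRes h (R n) = R n ∧ ∀ c ∈ Φ, h • c = g • c := by
  by_contra hcon
  obtain ⟨φ, hφ, hno⟩ := extraction_of_frequently_atTop (not_eventually.1 hcon)
  obtain ⟨x⟩ := X.chamber_nonempty
  obtain ⟨α, hα, hα1⟩ := exists_apartMap_one x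
  have hk : ∀ n, ∃ k : G, k • x = x ∧ ∃ w, α w ∈ (X.actRes k (R (φ n))).1 := by
    intro n
    obtain ⟨d, hd⟩ := res_nonempty (R (φ n))
    obtain ⟨k, h1, h2⟩ := exists_smul_pair hst (C := x) (D := d) (C' := x) (D' := α (X.delta x d))
      (by conv_rhs => rw [← hα1, hα.2]
          simp [hα1])
    refine ⟨k, h1, X.delta x d, ?_⟩
    rw [← h2]
    exact mem_actRes.2 hd
  choose k hkx w hw using hk
  obtain ⟨a, ψ, hψ, ha⟩ := exists_subseq_tendsto hlf hGc hkx
  have hainv : ∀ c : X.Chamber, ∀ᶠ n in atTop, (k (ψ n))⁻¹ • c = a⁻¹ • c := fun c => by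
    filter_upwards [ha (a⁻¹ • c)] with n hn
    exact inv_smul_eq_of_smul_inv_smul hn
  set T : ℕ → X.Res := fun n => X.actRes (k (ψ n)) (R (φ (ψ n))) with hT
  have hsub : Tendsto (fun n => φ (ψ n)) atTop atTop := hφ.tendsto_atTop.comp hψ.tendsto_atTop
  set g' := a * g * a⁻¹ with hg'
  have hg'T : ∀ c, ∀ᶠ n in atTop, mm (T n) (g' • c) = mm (T n) c := by
    intro c
    filter_upwards [hainv c, hainv (g' • c), hsub.eventually (hg (a⁻¹ • c))] with n h1 h2 h3
    rw [hT]
    simp only [mm_actRes_left]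
    rw [h1, h2, ← h3, hg', mul_smul, mul_smul, inv_smul_smul]
  have hfinite := hlf.1
  have hball : ∀ m, {u : W | cs.length u ≤ m}.Finite := by
    intro m
    refine ((List.finite_length_le B m).image cs.wordProd).subset ?_
    intro u hu
    obtain ⟨ω, hω, rfl⟩ := cs.exists_isReduced u
    exact ⟨ω, by rw [Set.mem_ofPred_eq, ← hω.eq]; exact hu, rfl⟩
  have hm : ∀ m, ∃ n, m ≤ n ∧ ∃ h : G, X.actRes h (T n) = T n ∧
      ∀ u, cs.length u ≤ m → h • α u = g' • α u := by
    intro m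
    have h1 : ∀ᶠ n in atTop, ∀ u ∈ {u : W | cs.length u ≤ m},
        mm (T n) (g' • α u) = mm (T n) (α u) :=
      (hball m).eventually_all.2 fun u _ => hg'T (α u)
    obtain ⟨n, h2, h3⟩ := (h1.and (eventually_ge_atTop m)).exists
    exact ⟨n, h3, exists_actRes_of_mm_eq hst hα (hw (ψ n)) h2⟩
  choose N hN h hhT hhα using hm
  obtain ⟨b, θ, hθ, hb⟩ := exists_subseq_tendsto hlf hGc (g := h) (x := α 1) (y := g' • α 1)
    fun m => hhα m 1 (by simp)
  have hbα : ∀ u, b • α u = g' • α u := by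
    intro u
    obtain ⟨m, h1, h2⟩ := ((hb (α u)).and (hθ.tendsto_atTop.eventually_ge_atTop
      (cs.length u))).exists
    rw [← h1, hhα _ u h2]
  set f := b⁻¹ * g' with hf
  have hfα : ∀ u, f • α u = α u := fun u => by rw [hf, mul_smul, ← hbα, inv_smul_smul]
  have hfT : ∀ n, X.actRes f (T n) = T n := fun n =>
    actRes_eq_of_mem (hw (ψ n)) (by change f • α _ ∈ (T n).1; rw [hfα]; exact hw (ψ n))
  have hNt : Tendsto (fun m => N (θ m)) atTop atTop :=
    tendsto_atTop_mono (fun m => hN (θ m)) hθ.tendsto_atTop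
  have hfin : ∀ c : X.Chamber, ∀ᶠ m in atTop, ((k (ψ (N (θ m))))⁻¹ * h (θ m) * f * k (ψ (N (θ m)))) • c
      = g • c := by
    intro c
    filter_upwards [hNt.eventually (ha c), hb (f • a • c),
      hNt.eventually (hainv (g' • a • c))] with m h1 h2 h3
    rw [mul_smul, mul_smul, mul_smul, h1, h2, hf, mul_smul, smul_inv_smul, h3, hg', mul_smul,
      mul_smul, inv_smul_smul, inv_smul_smul]
  obtain ⟨m, hm⟩ := (hΦ.eventually_all.2 fun c (_ : c ∈ Φ) => hfin c).exists
  refine hno (ψ (N (θ m))) ⟨_, ?_, hm⟩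
  rw [mul_assoc, mul_assoc, actRes_coe_mul, actRes_coe_mul, actRes_coe_mul]
  change X.actRes _ (X.actRes _ (X.actRes _ (T (N (θ m))))) = _
  rw [hfT, hhT]
  exact actRes_inv_act _ _

end Bldg

namespace CoxeterSystem

variable (cs : CoxeterSystem M W)

/-- The simple reflections that stabilise all the cosets `v n * W_{I n}`. -/
def commonFlat (I : ℕ → Set B) (v : ℕ → W) : Set B :=
  {i | ∀ n, (v n)⁻¹ * cs.simple i * v n ∈ cs.para (I n)}

variable {cs}

theorem conj_mem_para {I J : Set B} {v x : W} (hJ : ∀ i ∈ J, v⁻¹ * cs.simple i * v ∈ cs.para I)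
    (hx : x ∈ cs.para J) : v⁻¹ * x * v ∈ cs.para I := by
  have h1 : cs.para J ≤ (cs.para I).comap (MulAut.conj v⁻¹).toMonoidHom := by
    rw [Subgroup.closure_le]
    rintro _ ⟨i, hi, rfl⟩
    simpa using hJ i hi
  simpa using h1 hx

theorem sphType_commonFlat {I : ℕ → Set B} (h : SphType cs (I 0)) (v : ℕ → W) :
    SphType cs (cs.commonFlat I v) := by
  refine Set.Finite.subset (Set.Finite.preimage (f := MulAut.conj (v 0)⁻¹)
    (MulEquiv.injective _).injOn h) fun x hx => ?_
  simpa using conj_mem_para (J := cs.commonFlat I v) (v := v 0) (I := I 0) (fun i hi => hi 0) hx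

end CoxeterSystem

namespace Bldg

open CoxeterSystem

variable {cs : CoxeterSystem M W} {X : Bldg cs} {G : Subgroup X.Aut}

theorem mm_eq_of_flat {J : Set B} {R : X.Res} {q q' : X.Chamber} (h : X.delta q q' ∈ cs.para J)
    (hJ : ∀ i ∈ J, (mm R q)⁻¹ * cs.simple i * mm R q ∈ cs.para (typ R)) : mm R q' = mm R q := by
  induction hn : cs.length (X.delta q q') using Nat.strong_induction_on generalizing q with
  | _ n ih =>
  by_cases h1 : X.delta q q' = 1
  · rw [(X.delta_eq_one_iff q q').1 h1]
  obtain ⟨i, hi, hd⟩ := cs.exists_dn_of_mem_para h h1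
  obtain ⟨F, hF1, hF2⟩ := X.exists_between (pre_simple_iff.2 hd)
  rw [inv_simple] at hF2
  have h2 := mm_adj_flat hF1 (hJ i hi)
  rw [← h2]
  exact ih (cs.length (X.delta F q')) (by rw [hF2, ← hn]; exact hd)
    (hF2 ▸ mul_mem (cs.simple_mem_para hi) h) (by rwa [h2]) rfl

/-- `z` is the face at the end of the common beginning of the geodesics from `c` to the
residues `R n`, where the distances from `c` are prescribed by the sequence `v`. -/
def IsEnd (R : ℕ → X.Res) (v : ℕ → W) (c : X.Chamber) (z : X.Res) : Prop :=
  ∃ (u : W) (e : X.Chamber), (∀ n, cs.Pre u (v n)) ∧ (∀ d, (∀ n, cs.Pre d (v n)) → cs.Pre d u) ∧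
    X.delta c e = u ∧ (∀ᶠ n in atTop, mm (R n) e = u⁻¹ * v n) ∧
    z.1 = X.residue (cs.commonFlat (fun n => typ (R n)) fun n => u⁻¹ * v n) e

variable {R : ℕ → X.Res} {ξ : X.Res → X.Res} {v : ℕ → W}

theorem exists_isEnd [Finite B] (hR : X.ConvSeq ξ R) {c : X.Chamber}
    (hc : ∀ᶠ n in atTop, mm (R n) c = v n) : ∃ z, IsEnd R v c z := by
  obtain ⟨u, hu, hu'⟩ := CoxeterSystem.exists_inf (cs := cs) v
  obtain ⟨e, he, he'⟩ := hR.exists_lift (c := c) (k := u) (hc.mono fun n hn => hn ▸ hu n)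
  refine ⟨X.resOf _ (sphType_commonFlat (I := fun n => typ (R n)) (typ_sph (R 0))
    fun n => u⁻¹ * v n) e, u, e, hu, hu', he,
    ?_, rfl⟩
  filter_upwards [hc, he'] with n h1 h2
  rw [h2, h1]

theorem IsEnd.unique {c : X.Chamber} (hc : ∀ᶠ n in atTop, mm (R n) c = v n) {z z' : X.Res}
    (h : IsEnd R v c z) (h' : IsEnd R v c z') : z = z' := by
  obtain ⟨u, e, h1, h2, h3, h4, h5⟩ := h
  obtain ⟨u', e', h1', h2', h3', h4', h5'⟩ := h'
  obtain rfl : u = u' := (h2' u h1).antisymm (h2 u' h1')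
  obtain ⟨n, hn, hn', hn''⟩ := (hc.and (h4.and h4')).exists
  have : e = e' := by
    refine lift_unique (R := R n) (c := c) ?_ ?_ (by rw [h3, h3']) (by rw [hn', hn''])
    · rw [h3, hn]; exact h1 n
    · rw [h3, hn, hn']
  subst this
  exact res_ext (by rw [h5, h5'])

theorem IsEnd.of_pre {c b : X.Chamber} {k : W} (hb : X.delta c b = k) (hk : ∀ n, cs.Pre k (v n))
    {z : X.Res} (h : IsEnd R (fun n => k⁻¹ * v n) b z) : IsEnd R v c z := by
  obtain ⟨u, e, h1, h2, h3, h4, h5⟩ := h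
  have e1 : ∀ n, (k * u)⁻¹ * v n = u⁻¹ * (k⁻¹ * v n) := fun n => by simp [mul_assoc]
  have h6 : ∀ n, cs.Pre (k * u) (v n) ∧ cs.Pre k (k * u) := fun n =>
    (hk n).of_inv_mul (by rw [inv_mul_cancel_left]; exact h1 n)
  refine ⟨k * u, e, fun n => (h6 n).1, fun d hd => ?_, ?_, ?_, ?_⟩
  · obtain ⟨m, hm, hm'⟩ := CoxeterSystem.exists_inf (cs := cs) v
    have h7 := hm' k hk
    have h8 := h2 (k⁻¹ * m) fun n => (h7.inv_mul (hm n)).2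
    have h9 : cs.Pre m (k * u) := ((h6 0).2.of_inv_mul (by rwa [inv_mul_cancel_left])).1
    exact (hm' d hd).trans h9
  · rw [X.delta_add (D := b), hb, h3]
    rw [hb, h3]
    have := (h6 0).2
    rw [Pre, inv_mul_cancel_left] at this
    exact this.symm
  · filter_upwards [h4] with n hn
    rw [hn, e1]
  · rw [h5]
    simp only [e1]

theorem IsEnd.of_flat (hv : ∀ n, cs.RMin (typ (R n)) (v n)) {c c' : X.Chamber} {i : B}
    (hi : i ∈ cs.commonFlat (fun n => typ (R n)) v) (hcc : X.delta c c' = cs.simple i) {z : X.Res}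
    (h : IsEnd R v c z) : IsEnd R v c' z := by
  obtain ⟨u, e, h1, h2, h3, h4, h5⟩ := h
  obtain ⟨r, hr⟩ := exists_simple_of_inf hv hi h1 h2
  have hnd : ¬ cs.Dn (cs.simple i) u := fun hd =>
    (hv 0).not_dn (hi 0) (pre_simple_iff.1 ((pre_simple_iff.2 hd).trans (h1 0)))
  have h6 : X.delta c' e = u * cs.simple r := by
    rw [← hr, ← h3]
    exact X.delta_left_of_not_dn (X.delta_simple_symm hcc) (by rwa [h3])
  obtain ⟨e', he1, he2⟩ := X.exists_delta c' e r
  rw [h6, simple_mul_simple_cancel_right] at he2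
  have hrF : r ∈ cs.commonFlat (fun n => typ (R n)) fun n => u⁻¹ * v n := by
    intro n
    have : (u⁻¹ * v n)⁻¹ * cs.simple r * (u⁻¹ * v n) = (v n)⁻¹ * cs.simple i * v n := by
      have h7 : cs.simple i = u * cs.simple r * u⁻¹ := by rw [← hr]; group
      rw [h7]; group
    rw [this]
    exact hi n
  refine ⟨u, e', h1, h2, he2, ?_, ?_⟩
  · filter_upwards [h4] with n hn
    rw [← hn]
    refine mm_adj_flat he1 ?_
    rw [hn]
    exact hrF n
  · rw [h5]
    refine X.residue_eq ?_
    rw [mem_residue, he1]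
    exact cs.simple_mem_para hrF

theorem IsEnd.mem (hR : X.ConvSeq ξ R) [Finite B] {H : Set X.Res} (hcl : X.ClosedResSet H)
    (hp : ∀ σ ∈ H, ∀ᶠ n in atTop, X.projRes σ (R n) ∈ H) (hv : ∀ n, cs.RMin (typ (R n)) (v n))
    {c : X.Chamber} (hc : ∀ᶠ n in atTop, mm (R n) c = v n) {f z : X.Res} (hf : f ∈ H)
    (hfc : f.1 = X.residue (cs.commonFlat (fun n => typ (R n)) v) c) (h : IsEnd R v c z) :
    z ∈ H := by
  induction hn : cs.length (v 0) using Nat.strong_induction_on generalizing v c f with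
  | _ m ih =>
  by_cases hs : ∃ s, ∀ n, cs.Dn (cs.simple s) (v n)
  swap
  · obtain ⟨u, e, h1, h2, h3, h4, h5⟩ := h
    obtain rfl : u = 1 := by
      by_contra hu
      obtain ⟨s, hs'⟩ := cs.exists_leftDescent_of_ne_one hu
      exact hs ⟨s, fun n => pre_simple_iff.1 ((pre_simple_iff.2 hs').trans (h1 n))⟩
    obtain rfl := (X.delta_eq_one_iff _ _).1 h3
    have : z = f := res_ext (by rw [h5, hfc]; simp)
    rwa [this]
  obtain ⟨s, hs⟩ := hs
  set F := cs.commonFlat (fun n => typ (R n)) v with hF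
  set T := insert s F with hT
  have hFT : F ⊆ T := Set.subset_insert _ _
  have hvF : ∀ n, cs.LMin F (v n) := fun n i hi => (hv n).not_dn (hi n)
  obtain ⟨wF, hwF⟩ := exists_isLongest_of_finite (cs := cs)
    (sphType_commonFlat (I := fun n => typ (R n)) (typ_sph (R 0)) v : SphType cs F)
  have hw' : ∀ n, (v n)⁻¹ * (wF * v n) ∈ cs.para (typ (R n)) := by
    intro n
    rw [← mul_assoc]
    exact conj_mem_para (J := F) (fun i hi => hi n) hwF.1
  have hdn : ∀ n, ∀ t ∈ T, cs.Dn (cs.simple t) (wF * v n) := by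
    rintro n t (rfl | ht)
    · have h1 := (hv n).length_mul (hw' n)
      rw [mul_inv_cancel_left] at h1
      have h2 := hs n
      have h3 := cs.length_mul_le (cs.simple t * v n) ((v n)⁻¹ * (wF * v n))
      rw [mul_assoc, mul_inv_cancel_left] at h3
      unfold Dn at h2 ⊢
      omega
    · rw [cs.dn_mul_of_forall hwF.1 ((hvF n).forall) (cs.isReflection_simple t)
        (cs.simple_mem_para ht)]
      exact hwF.dn ht
  obtain ⟨wT, hwT, _, _⟩ := exists_isLongest (hdn 0)
  have hTy : ∀ n, cs.Pre wT (wF * v n) ∧ cs.LMin T (wT⁻¹ * (wF * v n)) := by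
    intro n
    obtain ⟨k, hk, hk1, hk2⟩ := exists_isLongest (hdn n)
    rw [hwT.unique hk]
    exact ⟨hk1, hk2⟩
  set k := wF⁻¹ * wT with hk
  have hky : ∀ n, k⁻¹ * v n = wT⁻¹ * (wF * v n) := fun n => by rw [hk]; group
  have hkv : ∀ n, cs.Pre k (v n) := by
    intro n
    have h1 := (hTy n).1
    have h2 := (hvF n).length_mul _ hwF.1
    have h3 := hwT.2 wF (cs.para_mono hFT hwF.1)
    unfold Pre at h1 h3 ⊢
    rw [hky, hk]
    omega
  obtain ⟨b, hb, hb'⟩ := hR.exists_lift (c := c) (k := k) (hc.mono fun n hn => hn ▸ hkv n)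
  have hby : ∀ᶠ n in atTop, mm (R n) b = k⁻¹ * v n := by
    filter_upwards [hc, hb'] with n h1 h2
    rw [h2, h1]
  have hTsph : SphType cs T := finite_para (hdn 0)
  have hσ : X.resOf T hTsph c ∈ H := hcl _ f (by
    change f.1 ⊆ X.residue T c
    rw [hfc]
    exact X.residue_mono hFT c) hf
  have hkT : k ∈ cs.para T := mul_mem (inv_mem (cs.para_mono hFT hwF.1)) hwT.1
  have hσb : (X.resOf T hTsph c).1 = X.residue T b :=
    X.residue_eq (by rw [mem_residue, hb]; exact hkT)
  obtain ⟨n, hn1, hn2⟩ := ((hp _ hσ).and hby).exists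
  have hsub : {t ∈ T | (mm (R n) b)⁻¹ * cs.simple t * mm (R n) b ∈ cs.para (typ (R n))} ⊆
      cs.commonFlat (fun n => typ (R n)) fun n => k⁻¹ * v n := by
    rintro t ⟨htT, ht⟩
    obtain ⟨r, hrT, hr⟩ := hwT.conj htT
    have key : ∀ m, (k⁻¹ * v m)⁻¹ * cs.simple t * (k⁻¹ * v m) ∈ cs.para (typ (R m)) ↔
        (v m)⁻¹ * cs.simple r * v m ∈ cs.para (typ (R m)) := by
      intro m
      have h1 : (k⁻¹ * v m)⁻¹ * cs.simple t * (k⁻¹ * v m) =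
          ((v m)⁻¹ * (wF * v m))⁻¹ * ((v m)⁻¹ * cs.simple r * v m) *
            ((v m)⁻¹ * (wF * v m)) := by
        rw [hky, ← hr]
        nth_rewrite 2 [← hwT.inv_eq]
        group
      have h2 := hw' m
      rw [h1, Subgroup.mul_mem_cancel_right _ h2, Subgroup.mul_mem_cancel_left _ (inv_mem h2)]
    rw [hn2, key] at ht
    have hrF : r ∈ F := by
      rcases hrT with rfl | hrF
      · exact absurd (hs n) ((hv n).not_dn ht)
      · exact hrF
    exact fun m => (key m).2 (hrF m)
  have hf' : X.resOf _ (sphType_commonFlat (I := fun n => typ (R n)) (typ_sph (R 0))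
      fun n => k⁻¹ * v n) b ∈ H := by
    refine hcl _ _ ?_ hn1
    change (X.projRes _ _).1 ⊆ X.residue _ b
    rw [projRes_val, hσb, projSet_eq (by rw [hn2, hky]; exact (hTy n).2)]
    exact X.residue_mono hsub b
  obtain ⟨z', hz'⟩ := exists_isEnd hR hby
  obtain rfl := h.unique hc (hz'.of_pre hb hkv)
  refine ih (cs.length (k⁻¹ * v 0)) ?_ (fun n => (hkv n).rmin (hv n)) hby hf' rfl hz' rfl
  have hk1 : k ≠ 1 := by
    intro hk1
    have := (hTy 0).2 s (Set.mem_insert _ _)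
    rw [← hky, hk1, inv_one, one_mul] at this
    exact this (hs 0)
  have h1 := hkv 0
  have h2 : cs.length k ≠ 0 := fun h => hk1 (cs.length_eq_zero_iff.1 h)
  unfold Pre at h1
  omega

end Bldg

namespace Bldg

open CoxeterSystem

variable {cs : CoxeterSystem M W} {X : Bldg cs} {G : Subgroup X.Aut}
  {R : ℕ → X.Res} {ξ : X.Res → X.Res}

theorem ConvSeq.comp (hR : X.ConvSeq ξ R) {φ : ℕ → ℕ} (hφ : Tendsto φ atTop atTop) :
    X.ConvSeq ξ (R ∘ φ) := Tendsto.comp (g := fun n => X.projr (R n)) hR hφ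

/-- `IsEnd` for the `N`-th tail of the sequence `R`. -/
def IsEndAt (R : ℕ → X.Res) (N : ℕ) (c : X.Chamber) (z : X.Res) : Prop :=
  IsEnd (fun n => R (n + N)) (fun n => mm (R (n + N)) c) c z

theorem exists_isEndAt [Finite B] (hR : X.ConvSeq ξ R) (N : ℕ) (c : X.Chamber) :
    ∃ z, IsEndAt R N c z :=
  exists_isEnd (hR.comp (tendsto_add_atTop_nat N)) (Eventually.of_forall fun _ => rfl)

theorem IsEndAt.unique {N : ℕ} {c : X.Chamber} {z z' : X.Res} (h : IsEndAt R N c z)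
    (h' : IsEndAt R N c z') : z = z' :=
  IsEnd.unique (Eventually.of_forall fun _ => rfl) h h'

/-- The ends seen from `c` and from `c'` eventually agree. -/
def SameEnd (R : ℕ → X.Res) (c c' : X.Chamber) : Prop :=
  ∀ᶠ N in atTop, ∀ z, IsEndAt R N c z ↔ IsEndAt R N c' z

theorem SameEnd.symm {c c' : X.Chamber} (h : SameEnd R c c') : SameEnd R c' c :=
  h.mono fun _ hN z => (hN z).symm

theorem SameEnd.trans {c c' c'' : X.Chamber} (h : SameEnd R c c') (h' : SameEnd R c' c'') :
    SameEnd R c c'' := by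
  filter_upwards [h, h'] with N h1 h2 z
  rw [h1, h2]

theorem sameEnd_of_imp [Finite B] (hR : X.ConvSeq ξ R) {c c' : X.Chamber}
    (h : ∀ᶠ N in atTop, ∀ z, IsEndAt R N c z → IsEndAt R N c' z) : SameEnd R c c' := by
  filter_upwards [h] with N hN z
  refine ⟨hN z, fun hz => ?_⟩
  obtain ⟨z', hz'⟩ := exists_isEndAt hR N c
  rwa [hz.unique (hN z' hz')]

theorem sameEnd_of_dn [Finite B] (hR : X.ConvSeq ξ R) {c p : X.Chamber} {i : B}
    (hp : X.delta c p = cs.simple i) (hd : ∀ᶠ n in atTop, cs.Dn (cs.simple i) (mm (R n) c))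
    (hm : ∀ᶠ n in atTop, mm (R n) p = cs.simple i * mm (R n) c) : SameEnd R p c := by
  refine sameEnd_of_imp hR ?_
  filter_upwards [eventually_forall_ge_atTop.2 (hd.and hm)] with N hN z hz
  refine IsEnd.of_pre hp (fun n => pre_simple_iff.2 (hN (n + N) (Nat.le_add_left _ _)).1) ?_
  have : (fun n => (cs.simple i)⁻¹ * mm (R (n + N)) c) = fun n => mm (R (n + N)) p :=
    funext fun n => by rw [inv_simple, (hN (n + N) (Nat.le_add_left _ _)).2]
  rw [this]
  exact hz

theorem sameEnd_of_eventually_dn [Finite B] (hR : X.ConvSeq ξ R) {c c' : X.Chamber} {i : B}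
    (h : X.delta c c' = cs.simple i) (hd : ∀ᶠ n in atTop, cs.Dn (cs.simple i) (mm (R n) c)) :
    SameEnd R c c' := by
  obtain ⟨p, hp, hm⟩ := hR.exists_adj hd
  have h1 := (sameEnd_of_dn hR hp hd hm).symm
  have hpan : c' ∈ X.residue {i} p := by
    have h2 : X.residue {i} c = X.residue {i} p := by
      refine X.residue_eq ?_
      rw [mem_residue, hp]
      exact cs.simple_mem_para rfl
    rw [← h2, mem_residue, h]
    exact cs.simple_mem_para rfl
  rcases mem_residue_singleton.1 hpan with rfl | h2
  · exact h1
  · have h3 : ∀ᶠ n in atTop, mm (R n) c' = mm (R n) c := by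
      filter_upwards [hm, hd] with n h3 h4
      have h5 : ¬ cs.Dn (cs.simple i) (mm (R n) p) := by
        rw [h3, dn_simple_mul]; exact fun h => h h4
      have h6 : (mm (R n) p)⁻¹ * cs.simple i * mm (R n) p ∉ cs.para (typ (R n)) := by
        intro h6
        have h7 := mm_adj_flat (X.delta_simple_symm hp) h6
        rw [h7] at h4
        exact h5 h4
      rw [mm_adj_up h2 h5 h6, h3, simple_mul_simple_cancel_left]
    refine h1.trans (sameEnd_of_dn hR (X.delta_simple_symm h2) ?_ ?_)
    · filter_upwards [h3, hd] with n h4 h5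
      rwa [h4]
    · filter_upwards [h3, hm] with n h4 h5
      rw [h4, h5]

theorem sameEnd_adj [Finite B] (hR : X.ConvSeq ξ R) {c c' : X.Chamber} {i : B}
    (h : X.delta c c' = cs.simple i) : SameEnd R c c' := by
  rcases hR.dn_or c i with hc | hc
  · exact sameEnd_of_eventually_dn hR h hc
  rcases hR.dn_or c' i with hc' | hc'
  · exact (sameEnd_of_eventually_dn hR (X.delta_simple_symm h) hc').symm
  refine sameEnd_of_imp hR ?_
  filter_upwards [eventually_forall_ge_atTop.2 (hc.and hc')] with N hN z hz
  have hfl : i ∈ cs.commonFlat (fun n => typ (R (n + N))) fun n => mm (R (n + N)) c := by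
    intro n
    by_contra hcon
    obtain ⟨h1, h2⟩ := hN (n + N) (Nat.le_add_left _ _)
    rw [mm_adj_up h h1 hcon, dn_simple_mul] at h2
    exact h2 h1
  have : (fun n => mm (R (n + N)) c') = fun n => mm (R (n + N)) c :=
    funext fun n => mm_adj_flat h (hfl n)
  unfold IsEndAt
  rw [this]
  exact IsEnd.of_flat (fun n => mm_rmin _ _) hfl h hz

theorem sameEnd [Finite B] (hR : X.ConvSeq ξ R) (c c' : X.Chamber) : SameEnd R c c' := by
  induction hn : cs.length (X.delta c c') using Nat.strong_induction_on generalizing c' with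
  | _ n ih =>
  by_cases h1 : X.delta c c' = 1
  · obtain rfl := (X.delta_eq_one_iff _ _).1 h1
    exact Eventually.of_forall fun _ _ => Iff.rfl
  obtain ⟨i, hi⟩ := cs.exists_rightDescent_of_ne_one h1
  obtain ⟨F, hF1, hF2⟩ := X.exists_delta c c' i
  rw [isRightDescent_iff, ← hF2] at hi
  exact (ih _ (by omega) F rfl).trans (sameEnd_adj hR (X.delta_simple_symm hF1))

theorem IsEnd.smul {v : ℕ → W} {c : X.Chamber} {z : X.Res} (h : IsEnd R v c z) {g : G}
    (hg : g ∈ asymStab G R) : IsEnd R v (g • c) (X.actRes g z) := by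
  obtain ⟨u, e, h1, h2, h3, h4, h5⟩ := h
  refine ⟨u, g • e, h1, h2, by rw [delta_smul', h3], ?_, ?_⟩
  · filter_upwards [h4, hg e] with n h6 h7
    rw [h7, h6]
  · rw [actRes_val, h5, smul_residue]
    rfl

theorem asymStab_comp_subset {φ : ℕ → ℕ} (hφ : Tendsto φ atTop atTop) :
    asymStab G R ⊆ asymStab G (R ∘ φ) := fun _ hg c => hφ.eventually (hg c)

theorem actRes_congr {g h : G} {z : X.Res} (hgh : ∀ c ∈ z.1, h • c = g • c) :
    X.actRes h z = X.actRes g z := by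
  apply res_ext
  rw [actRes_val, actRes_val]
  exact Set.image_congr hgh

theorem exists_fix_of_mem_asymStab (hlf : X.LocallyFinite) (hGc : IsClosed (G : Set X.Aut))
    (hst : X.StronglyTransitive G) (hR : X.ConvSeq ξ R) {g : G} (hg : g ∈ asymStab G R) :
    ∃ x, ∀ Q ∈ X.Qseq x R, X.actRes g Q = Q := by
  have := hlf.1
  obtain ⟨c⟩ := X.chamber_nonempty
  obtain ⟨N, hN1, hN2⟩ := ((sameEnd hR c (g • c)).and
    (eventually_forall_ge_atTop.2 (hg c))).exists
  obtain ⟨z, hz⟩ := exists_isEndAt hR N c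
  have h1 : IsEndAt R N (g • c) (X.actRes g z) := by
    have h2 := IsEnd.smul hz (asymStab_comp_subset (tendsto_add_atTop_nat N) hg)
    have h3 : (fun n => mm (R (n + N)) (g • c)) = fun n => mm (R (n + N)) c :=
      funext fun n => hN2 _ (Nat.le_add_left _ _)
    unfold IsEndAt
    rwa [h3]
  have hgz : X.actRes g z = z := h1.unique ((hN1 z).1 hz)
  refine ⟨z, fun Q hQ => ?_⟩
  obtain ⟨k, hk⟩ := Set.mem_iUnion.1 hQ
  obtain ⟨n, ⟨h, hh1, hh2⟩, hn⟩ := ((eventually_exists_actRes hlf hGc hst hg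
    ((finite_res hlf z).union (finite_res hlf Q))).and (eventually_ge_atTop k)).exists
  have hQn := Set.mem_iInter₂.1 hk n hn
  rw [← actRes_congr (h := h) (g := g) fun c hc => hh2 c (Or.inr hc)]
  refine actRes_eq_of_mem_conv2 ?_ hh1 hQn
  rw [actRes_congr (h := h) (g := g) fun c hc => hh2 c (Or.inl hc), hgz]

theorem left_mem_conv2 (x T : X.Res) : x ∈ X.conv2 x T := fun _ hS => hS.2 (Or.inl rfl)

theorem right_mem_conv2 (x T : X.Res) : T ∈ X.conv2 x T := fun _ hS => hS.2 (Or.inr rfl)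

theorem convexResSet_conv2 (x T : X.Res) : X.ConvexResSet (X.conv2 x T) :=
  ⟨fun R₁ R₂ h hR S hS => hS.1.1 R₁ R₂ h (hR S hS),
    fun R₁ h1 R₂ h2 S hS => hS.1.2 R₁ (h1 S hS) R₂ (h2 S hS)⟩

theorem mem_Qseq {x Q : X.Res} : Q ∈ X.Qseq x R ↔ ∀ᶠ n in atTop, Q ∈ X.conv2 x (R n) := by
  simp [Qseq, eventually_atTop]

theorem closedResSet_Qseq (x : X.Res) (R : ℕ → X.Res) : X.ClosedResSet (X.Qseq x R) := by
  intro R₁ R₂ h h2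
  rw [mem_Qseq] at h2 ⊢
  exact h2.mono fun n hn => (convexResSet_conv2 x (R n)).1 R₁ R₂ h hn

theorem ConvSeq.limit_mem_Qseq (hR : X.ConvSeq ξ R) {x σ : X.Res} (hσ : σ ∈ X.Qseq x R) :
    ξ σ ∈ X.Qseq x R := by
  rw [mem_Qseq] at hσ ⊢
  filter_upwards [hσ, hR.eventually σ] with n h1 h2
  rw [← h2]
  exact (convexResSet_conv2 x (R n)).2 σ h1 _ (right_mem_conv2 x (R n))

theorem mem_asymStab_of_fix [Finite B] (hR : X.ConvSeq ξ R) {g : G} {x : X.Res}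
    (hx : ∀ Q ∈ X.Qseq x R, X.actRes g Q = Q) : g ∈ asymStab G R := by
  have hcl := closedResSet_Qseq x R
  have hxQ : x ∈ X.Qseq x R := mem_Qseq.2 (Eventually.of_forall fun n => left_mem_conv2 _ _)
  obtain ⟨c₀, hc₀⟩ := res_nonempty (ξ x)
  have hsmall : ∀ᶠ n in atTop, cs.LMin (typ x) (mm (R n) c₀) ∧ (ξ x).1 = X.residue
      {t ∈ typ x | (mm (R n) c₀)⁻¹ * cs.simple t * mm (R n) c₀ ∈ cs.para (typ (R n))} c₀ := by
    filter_upwards [hR.eventually x] with n hn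
    rw [← hn, projRes_val, mem_projSet_res] at hc₀
    rw [← hn, projRes_val, eq_residue hc₀.1, projSet_eq hc₀.2]
    exact ⟨hc₀.2, rfl⟩
  intro c
  obtain ⟨N, hN1, hN2⟩ := ((sameEnd hR c₀ c).and
    (eventually_forall_ge_atTop.2 hsmall)).exists
  have hR' : X.ConvSeq ξ fun n => R (n + N) := hR.comp (tendsto_add_atTop_nat N)
  obtain ⟨z, hz⟩ := exists_isEndAt hR N c₀
  have hf : X.resOf _ (sphType_commonFlat (I := fun n => typ (R (n + N))) (typ_sph _)
      fun n => mm (R (n + N)) c₀) c₀ ∈ X.Qseq x R := by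
    refine hcl _ _ ?_ (hR.limit_mem_Qseq hxQ)
    change (ξ x).1 ⊆ X.residue (cs.commonFlat (fun n => typ (R (n + N)))
      fun n => mm (R (n + N)) c₀) c₀
    rw [(hN2 N le_rfl).2]
    refine X.residue_mono ?_ c₀
    intro t ht n
    have h1 := X.para_eq_of_residue_eq
      ((hN2 N le_rfl).2.symm.trans (hN2 (n + N) (Nat.le_add_left _ _)).2)
    refine conj_mem_para (fun i hi => ?_) (h1 ▸ cs.simple_mem_para ht)
    exact hi.2
  have hzQ : z ∈ X.Qseq x R := by
    refine IsEnd.mem hR' hcl (fun σ hσ => ?_) (fun n => mm_rmin _ _)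
      (Eventually.of_forall fun _ => rfl) hf rfl hz
    filter_upwards [hR'.eventually σ] with n hn
    rw [hn]
    exact hR.limit_mem_Qseq hσ
  obtain ⟨u, e, h1, h2, h3, h4, h5⟩ := (hN1 z).1 hz
  have hge : g • e ∈ X.residue (cs.commonFlat (fun n => typ (R (n + N)))
      fun n => u⁻¹ * mm (R (n + N)) c) e := by
    rw [← h5]
    refine smul_mem_of_actRes (hx z hzQ) ?_
    rw [h5]
    exact X.self_mem_residue _ _
  rw [← map_add_atTop_eq_nat N, eventually_map]
  show ∀ᶠ n in atTop, mm (R (n + N)) (g • c) = mm (R (n + N)) c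
  filter_upwards [h4] with n hn
  have h6 : mm (R (n + N)) (g • e) = u⁻¹ * mm (R (n + N)) c := by
    rw [← hn]
    refine mm_eq_of_flat hge fun i hi => ?_
    rw [hn]
    exact hi n
  have h7 : X.delta (g • c) (X.gate (R (n + N)).1 (g • e)) = mm (R (n + N)) c := by
    have h8 : X.delta (g • c) (g • e) * X.delta (g • e) (X.gate (R (n + N)).1 (g • e)) =
        mm (R (n + N)) c := by
      change _ * mm (R (n + N)) (g • e) = _
      rw [delta_smul', h3, h6, mul_inv_cancel_left]
    rw [← h8]
    refine X.delta_add ?_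
    rw [h8, delta_smul', h3]
    change _ = _ + cs.length (mm (R (n + N)) (g • e))
    rw [h6]
    exact (h1 n).symm
  refine mm_eq_of_coset (gate_mem _ (g • e)) (mm_rmin _ _) ?_
  rw [h7, inv_mul_cancel]
  exact one_mem _

theorem asymStab_comp (hlf : X.LocallyFinite) (hGc : IsClosed (G : Set X.Aut))
    (hst : X.StronglyTransitive G) (hR : X.ConvSeq ξ R) {φ : ℕ → ℕ} (hφ : Tendsto φ atTop atTop) :
    asymStab G (R ∘ φ) = asymStab G R := by
  have := hlf.1
  refine Set.Subset.antisymm (fun g hg => ?_) (asymStab_comp_subset hφ)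
  obtain ⟨x, hx⟩ := exists_fix_of_mem_asymStab hlf hGc hst (hR.comp hφ) hg
  exact mem_asymStab_of_fix hR fun Q hQ => hx Q (mem_Qseq.2 (hφ.eventually (mem_Qseq.1 hQ)))

theorem asymStab_eq (hlf : X.LocallyFinite) (hGc : IsClosed (G : Set X.Aut))
    (hst : X.StronglyTransitive G) (hR : X.ConvSeq ξ R) {R' : ℕ → X.Res}
    (hR' : X.ConvSeq ξ R') : asymStab G R = asymStab G R' := by
  have half : Tendsto (fun n : ℕ => n / 2) atTop atTop := Nat.tendsto_div_const_atTop two_ne_zero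
  have hS : X.ConvSeq ξ fun n => if Even n then R (n / 2) else R' (n / 2) := by
    have := Tendsto.if' (p := Even) (hR.comp half) (hR'.comp half)
    refine this.congr fun n => ?_
    simp only [apply_ite X.projr, Function.comp]
  have h1 := asymStab_comp hlf hGc hst hS (φ := fun n => 2 * n)
    (tendsto_atTop_mono (fun n => by simp only [id]; omega) tendsto_id)
  have h2 := asymStab_comp hlf hGc hst hS (φ := fun n => 2 * n + 1)
    (tendsto_atTop_mono (fun n => by simp only [id]; omega) tendsto_id)
  have e1 : ((fun n => if Even n then R (n / 2) else R' (n / 2)) ∘ fun n => 2 * n) = R := by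
    funext n; simp
  have e2 : ((fun n => if Even n then R (n / 2) else R' (n / 2)) ∘ fun n => 2 * n + 1) = R' := by
    funext n
    have : (2 * n + 1) / 2 = n := by omega
    simp [this]
  rw [e1] at h1
  rw [e2] at h2
  rw [h1, h2]

end Bldg

namespace Bldg

open CoxeterSystem

variable {cs : CoxeterSystem M W} {X : Bldg cs} {G : Subgroup X.Aut}
  {R R' : ℕ → X.Res} {ξ ζ : X.Res → X.Res}

/-- `asymStab` as a subgroup. -/
def asymSubgroup (G : Subgroup X.Aut) (R : ℕ → X.Res) : Subgroup G where
  carrier := asymStab G R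
  one_mem' c := by simp
  mul_mem' {g h} hg hh c := by
    filter_upwards [hg (h • c), hh c] with n h1 h2
    rw [mul_smul, h1, h2]
  inv_mem' {g} hg c := by
    filter_upwards [hg (g⁻¹ • c)] with n h1
    rw [← h1, smul_inv_smul]

theorem isClosed_asymStab (G : Subgroup X.Aut) (R : ℕ → X.Res) : IsClosed (asymStab G R) := by
  refine isClosed_of_closure_subset fun g hg c => ?_
  obtain ⟨h, h1, h2⟩ := mem_closure_iff.1 hg _ (isOpen_agree g (Set.finite_singleton c))
    fun _ _ => rfl
  rw [← h1 c rfl]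
  exact h2 c

theorem mm_eq_one_iff {T : X.Res} {c : X.Chamber} : mm T c = 1 ↔ c ∈ T.1 := by
  constructor
  · intro h
    rw [(X.delta_eq_one_iff _ _).1 h]
    exact gate_mem T c
  · intro h
    exact mm_eq_of_coset h (rmin_one _) (by simp [delta_self])

theorem gstab_eq_asymStab (T : X.Res) : X.gstab G T = asymStab G fun _ => T := by
  ext g
  constructor
  · intro h c
    exact Eventually.of_forall fun _ => mm_smul_of_actRes h c
  · intro h
    obtain ⟨c, hc⟩ := res_nonempty T
    obtain ⟨_, hn⟩ := (h c).exists
    rw [mm_eq_one_iff.2 hc, mm_eq_one_iff] at hn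
    exact actRes_eq_of_mem hc hn

theorem convSeq_const (T : X.Res) : X.ConvSeq (X.projr T) fun _ => T := tendsto_const_nhds

theorem ConvSeq.actRes (hR : X.ConvSeq ξ R) (g : X.Aut) :
    X.ConvSeq (X.actCr g ξ) fun n => X.actRes g (R n) := by
  refine tendsto_pi_nhds.2 fun σ => ?_
  rw [nhds_discrete, tendsto_pure]
  filter_upwards [hR.eventually (X.actRes g⁻¹ σ)] with n hn
  change X.projRes σ _ = X.actRes g _
  rw [← hn, ← projRes_actRes, actRes_act_inv]

theorem asymStab_actRes (g : G) (R : ℕ → X.Res) :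
    asymStab G (fun n => X.actRes g (R n)) = (fun h => g * h * g⁻¹) '' asymStab G R := by
  ext k
  constructor
  · intro hk
    refine ⟨g⁻¹ * k * g, fun c => ?_, by group⟩
    filter_upwards [hk (g • c)] with n hn
    rw [mm_actRes_left, mm_actRes_left, inv_smul_smul] at hn
    rw [← hn, mul_smul, mul_smul]
  · rintro ⟨h, hh, rfl⟩ c
    filter_upwards [hh (g⁻¹ • c)] with n hn
    rw [mm_actRes_left, mm_actRes_left, ← hn, mul_smul, mul_smul, inv_smul_smul]

theorem ConvSeq.mem_limit_iff [Finite B] (hR : X.ConvSeq ξ R) {σ : X.Res} {q : X.Chamber} :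
    q ∈ (ξ σ).1 ↔ q ∈ σ.1 ∧
      ∀ i ∈ typ σ, ¬ ∀ᶠ n in atTop, cs.Dn (cs.simple i) (mm (R n) q) := by
  have h1 : ∀ᶠ n in atTop, ∀ i, (cs.Dn (cs.simple i) (mm (R n) q) ↔
      ∀ᶠ n in atTop, cs.Dn (cs.simple i) (mm (R n) q)) := by
    refine eventually_all.2 fun i => ?_
    rcases hR.dn_or q i with h | h
    · filter_upwards [h] with n hn
      exact iff_of_true hn h
    · filter_upwards [h] with n hn
      refine iff_of_false hn fun h' => ?_
      obtain ⟨m, h2, h3⟩ := (h.and h').exists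
      exact h2 h3
  obtain ⟨n, h2, h3⟩ := (h1.and (hR.eventually σ)).exists
  rw [← h3, projRes_val, mem_projSet_res]
  simp only [← h2, LMin]

theorem exists_convSeq (hlf : X.LocallyFinite)
    (hξ : ξ ∈ X.Cr) : ∃ R : ℕ → X.Res, X.ConvSeq ξ R := by
  have := countable_res hlf
  obtain ⟨x, hx, h⟩ := mem_closure_iff_seq_limit.1 hξ
  choose R hR using hx
  exact ⟨R, by simpa only [ConvSeq, hR] using h⟩

theorem finite_star (hlf : X.LocallyFinite) (σ : X.Res) : (X.star σ).Finite :=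
  (finite_res hlf σ).finite_subsets.preimage Subtype.val_injective.injOn

theorem isCompact_Cr (hlf : X.LocallyFinite) : IsCompact X.Cr := by
  have h1 : IsCompact (Set.univ.pi fun σ : X.Res => X.star σ) :=
    isCompact_univ_pi fun σ => (finite_star hlf σ).isCompact
  refine h1.of_isClosed_subset isClosed_closure
    (closure_minimal ?_ (isClosed_set_pi fun σ _ => isClosed_discrete _))
  rintro _ ⟨T, rfl⟩ σ _
  change (X.projRes σ T).1 ⊆ σ.1
  rw [projRes_val]
  exact fun q hq => (mem_projSet_res.1 hq).1

theorem exists_isCompact_isOpen (hlf : X.LocallyFinite)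
    (hGc : IsClosed (G : Set X.Aut)) {K U : Set G} (hK : IsCompact K)
    (hU : IsOpen U) (hKU : K ⊆ U) : ∃ O, IsCompact O ∧ IsOpen O ∧ K ⊆ O ∧ O ⊆ U := by
  refine hK.induction_on (p := fun K => ∃ O, IsCompact O ∧ IsOpen O ∧ K ⊆ O ∧ O ⊆ U)
    ⟨∅, isCompact_empty, isOpen_empty, subset_rfl, Set.empty_subset _⟩
    (fun s t hst ⟨O, h1, h2, h3, h4⟩ => ⟨O, h1, h2, hst.trans h3, h4⟩)
    (fun s t ⟨O, h1, h2, h3, h4⟩ ⟨O', h1', h2', h3', h4'⟩ => ⟨O ∪ O', h1.union h1', h2.union h2',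
      Set.union_subset_union h3 h3', Set.union_subset h4 h4'⟩) fun g hg => ?_
  obtain ⟨Φ, hΦ, hΦU⟩ := exists_agree_subset hU (hKU hg)
  obtain ⟨x⟩ := X.chamber_nonempty
  have ho : IsOpen {h : G | ∀ c ∈ insert x Φ, h • c = g • c} := isOpen_agree g (hΦ.insert x)
  exact ⟨_, mem_nhdsWithin_of_mem_nhds (ho.mem_nhds fun _ _ => rfl), _,
    isCompact_agree hlf hGc g (Set.insert_nonempty _ _), ho, subset_rfl,
    fun h hh => hΦU fun c hc => hh c (Set.mem_insert_of_mem _ hc)⟩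

theorem tendsto_chabauty (hlf : X.LocallyFinite)
    (hGc : IsClosed (G : Set X.Aut)) {ι : Type*} {l : Filter ι}
    {L : ι → ChabautySpace G} {D : ChabautySpace G}
    (h : ∀ O : Set G, IsCompact O → IsOpen O →
      ∀ᶠ n in l, (((L n).1 : Set G) ∩ O).Nonempty ↔ ((D.1 : Set G) ∩ O).Nonempty) :
    Tendsto L l (𝓝 D) := by
  refine TopologicalSpace.tendsto_nhds_generateFrom_iff.2 ?_
  rintro _ (⟨K, hK, rfl⟩ | ⟨U, hU, rfl⟩) hD
  · obtain ⟨O, h1, h2, h3, h4⟩ := exists_isCompact_isOpen hlf hGc hK D.2.isOpen_compl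
      (Set.disjoint_iff_inter_eq_empty.2 hD).symm.subset_compl_right
    filter_upwards [h O h1 h2] with n hn
    by_contra hcon
    obtain ⟨g, hg, hgK⟩ := Set.nonempty_iff_ne_empty.2 hcon
    obtain ⟨a, ha, haO⟩ := hn.1 ⟨g, hg, h3 hgK⟩
    exact h4 haO ha
  · obtain ⟨g, hg, hgU⟩ := hD
    obtain ⟨O, h1, h2, h3, h4⟩ := exists_isCompact_isOpen hlf hGc isCompact_singleton hU
      (Set.singleton_subset_iff.2 hgU)
    filter_upwards [h O h1 h2] with n hn
    exact (hn.2 ⟨g, hg, h3 rfl⟩).mono (Set.inter_subset_inter_right _ h4)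

theorem t2Space_chabauty (hlf : X.LocallyFinite)
    (hGc : IsClosed (G : Set X.Aut)) : T2Space (ChabautySpace G) := by
  have key : ∀ L L' : ChabautySpace G, ¬ (L.1 : Set G) ⊆ L'.1 →
      ∃ u v : Set (ChabautySpace G), IsOpen u ∧ IsOpen v ∧ L ∈ u ∧ L' ∈ v ∧ Disjoint u v := by
    intro L L' hL
    obtain ⟨g, hg, hg'⟩ := Set.not_subset.1 hL
    obtain ⟨O, h1, h2, h3, h4⟩ := exists_isCompact_isOpen hlf hGc isCompact_singleton
      L'.2.isOpen_compl (Set.singleton_subset_iff.2 hg')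
    refine ⟨_, _, .basic _ (Or.inr ⟨O, h2, rfl⟩), .basic _ (Or.inl ⟨O, h1, rfl⟩),
      ⟨g, hg, h3 rfl⟩, ?_, ?_⟩
    · exact Set.disjoint_iff_inter_eq_empty.1 (Set.disjoint_left.2 fun a ha haO => h4 haO ha)
    · refine Set.disjoint_left.2 fun a ha ha' => ?_
      exact ha.ne_empty ha'
  refine ⟨fun L L' hne => ?_⟩
  by_cases h : (L.1 : Set G) ⊆ L'.1
  · have h' : ¬ (L'.1 : Set G) ⊆ L.1 := fun h' =>
      hne (Subtype.ext (SetLike.coe_injective (h.antisymm h')))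
    obtain ⟨u, v, h1, h2, h3, h4, h5⟩ := key L' L h'
    exact ⟨v, u, h2, h1, h4, h3, h5.symm⟩
  · exact key L L' h

theorem DxiC_coe (hlf : X.LocallyFinite) (hGc : IsClosed (G : Set X.Aut))
    (hst : X.StronglyTransitive G)
    (hR : X.ConvSeq ξ R) : ((X.DxiC G ξ).1 : Set G) = asymStab G R := by
  have hR₀ : X.ConvSeq ξ (Classical.epsilon (X.ConvSeq ξ)) := Classical.epsilon_spec ⟨R, hR⟩
  have h1 : X.gfixSector G ξ = asymStab G R := by
    rw [asymStab_eq hlf hGc hst hR hR₀]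
    have := hlf.1
    ext g
    exact ⟨fun ⟨x, hx⟩ => mem_asymStab_of_fix hR₀ hx,
      fun hg => exists_fix_of_mem_asymStab hlf hGc hst hR₀ hg⟩
  rw [← h1]
  exact Classical.epsilon_spec (p := fun L : ChabautySpace G => (L.1 : Set G) = X.gfixSector G ξ)
    ⟨⟨asymSubgroup G R, isClosed_asymStab G R⟩, h1.symm⟩

theorem gstabC_eq_DxiC (hlf : X.LocallyFinite) (hGc : IsClosed (G : Set X.Aut))
    (hst : X.StronglyTransitive G)
    (T : X.Res) : X.gstabC G T = X.DxiC G (X.projr T) := by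
  refine Subtype.ext (SetLike.coe_injective ?_)
  rw [DxiC_coe hlf hGc hst (convSeq_const T), ← gstab_eq_asymStab]
  exact Classical.epsilon_spec (p := fun L : ChabautySpace G => (L.1 : Set G) = X.gstab G T)
    ⟨⟨asymSubgroup G fun _ => T, isClosed_asymStab G _⟩, (gstab_eq_asymStab T).symm⟩

theorem gstabC_coe (hlf : X.LocallyFinite) (hGc : IsClosed (G : Set X.Aut))
    (hst : X.StronglyTransitive G)
    (T : X.Res) : ((X.gstabC G T).1 : Set G) = X.gstab G T := by
  rw [gstabC_eq_DxiC hlf hGc hst, DxiC_coe hlf hGc hst (convSeq_const T), gstab_eq_asymStab]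

theorem mem_asymStab_of_tendsto (hlf : X.LocallyFinite) (hGc : IsClosed (G : Set X.Aut))
    (hst : X.StronglyTransitive G)
    (hR : X.ConvSeq ξ R) {φ : ℕ → ℕ} (hφ : Tendsto φ atTop atTop)
    {g : ℕ → G} (hg : ∀ n, X.actRes (g n) (R (φ n)) = R (φ n)) {a : G}
    (ha : ∀ c : X.Chamber, ∀ᶠ n in atTop, g n • c = a • c) : a ∈ asymStab G R := by
  rw [← asymStab_comp hlf hGc hst hR hφ]
  intro c
  filter_upwards [ha c] with n hn
  rw [← hn]
  exact mm_smul_of_actRes (hg n) c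

theorem eventually_gstabC_meets_iff (hlf : X.LocallyFinite) (hGc : IsClosed (G : Set X.Aut))
    (hst : X.StronglyTransitive G)
    (hR : X.ConvSeq ξ R) {O : Set G} (hO : IsCompact O)
    (hO' : IsOpen O) : ∀ᶠ n in atTop, (((X.gstabC G (R n)).1 : Set G) ∩ O).Nonempty ↔
      (((X.DxiC G ξ).1 : Set G) ∩ O).Nonempty := by
  simp only [DxiC_coe hlf hGc hst hR, gstabC_coe hlf hGc hst]
  by_cases h : (asymStab G R ∩ O).Nonempty
  · obtain ⟨g, hg, hgO⟩ := h
    obtain ⟨Φ, hΦ, hΦO⟩ := exists_agree_subset hO' hgO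
    filter_upwards [eventually_exists_actRes hlf hGc hst hg hΦ] with n ⟨h, h1, h2⟩
    exact ⟨fun _ => ⟨g, hg, hgO⟩, fun _ => ⟨h, h1, hΦO h2⟩⟩
  · by_contra hcon
    obtain ⟨φ, hφ, hno⟩ := extraction_of_frequently_atTop (not_eventually.1 hcon)
    have hex : ∀ n, (X.gstab G (R (φ n)) ∩ O).Nonempty := fun n => by
      by_contra h'
      exact hno n ⟨fun h'' => absurd h'' h', fun h'' => absurd h'' h⟩
    choose g hg hgO using hex
    have := firstCountable_group hlf G
    obtain ⟨a, haO, ψ, hψ, ha⟩ := hO.tendsto_subseq hgO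
    exact h ⟨a, mem_asymStab_of_tendsto hlf hGc hst hR (hφ.comp hψ).tendsto_atTop
      (fun n => hg (ψ n)) (tendsto_iff_eventually_smul.1 ha), haO⟩

theorem tendsto_gstabC (hlf : X.LocallyFinite) (hGc : IsClosed (G : Set X.Aut))
    (hst : X.StronglyTransitive G)
    (hR : X.ConvSeq ξ R) :
    Tendsto (fun n => X.gstabC G (R n)) atTop (𝓝 (X.DxiC G ξ)) :=
  tendsto_chabauty hlf hGc fun _ h1 h2 => eventually_gstabC_meets_iff hlf hGc hst hR h1 h2

theorem continuous_DxiC (hlf : X.LocallyFinite) (hGc : IsClosed (G : Set X.Aut))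
    (hst : X.StronglyTransitive G)
    : Continuous fun ξ : X.Cr => X.DxiC G ξ.1 := by
  rw [continuous_iff_continuousAt]
  rintro ⟨ξ, hξ⟩
  refine tendsto_chabauty hlf hGc fun O h1 h2 => ?_
  have := countable_res hlf
  have hV : ∀ᶠ η in 𝓝 ξ, ∀ T, X.projr T = η → ((((X.gstabC G T).1 : Set G) ∩ O).Nonempty ↔
      (((X.DxiC G ξ).1 : Set G) ∩ O).Nonempty) := by
    by_contra hcon
    obtain ⟨η, hη, hno⟩ := exists_seq_forall_of_frequently (not_eventually.1 hcon)
    simp only [not_forall, exists_prop] at hno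
    choose R hR hR' using hno
    have hconv : X.ConvSeq ξ R := by simpa only [ConvSeq, hR] using hη
    obtain ⟨n, hn⟩ := (eventually_gstabC_meets_iff hlf hGc hst hconv h1 h2).exists
    exact hR' n hn
  filter_upwards [continuousAt_subtype_val.eventually hV.eventually_nhds] with η hη
  obtain ⟨R, hR⟩ := exists_convSeq hlf η.2
  obtain ⟨n, h3, h4⟩ := ((hR.eventually_mem hη).and
    (eventually_gstabC_meets_iff hlf hGc hst hR h1 h2)).exists
  rw [← h4]
  exact h3 _ rfl

theorem exists_mem_asymStab (hlf : X.LocallyFinite) (hGc : IsClosed (G : Set X.Aut))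
    (hst : X.StronglyTransitive G)
    (hR : X.ConvSeq ξ R) {a b : X.Chamber}
    (h : ∃ᶠ n in atTop, mm (R n) a = mm (R n) b) : ∃ g ∈ asymStab G R, g • a = b := by
  obtain ⟨φ, hφ, h1⟩ := extraction_of_frequently_atTop h
  have hex : ∀ n, ∃ g : G, X.actRes g (R (φ n)) = R (φ n) ∧ g • a = b := fun n => by
    obtain ⟨g, h2, h3⟩ := exists_smul_pair hst (h1 n)
    exact ⟨g, actRes_eq_of_mem (gate_mem _ a) (by
      change g • X.gate _ a ∈ _
      rw [h3]; exact gate_mem _ _), h2⟩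
  choose g hg hgab using hex
  obtain ⟨k, ψ, hψ, hk⟩ := exists_subseq_tendsto hlf hGc hgab
  refine ⟨k, mem_asymStab_of_tendsto hlf hGc hst hR (hφ.comp hψ).tendsto_atTop
    (fun n => hg (ψ n)) hk, ?_⟩
  obtain ⟨n, hn⟩ := (hk a).exists
  rw [← hn, hgab]

theorem eventually_dn_of_asymStab_eq (hlf : X.LocallyFinite) (hGc : IsClosed (G : Set X.Aut))
    (hst : X.StronglyTransitive G)
    (hth : X.Thick) (hR : X.ConvSeq ξ R) (hR' : X.ConvSeq ζ R')
    (h : asymStab G R = asymStab G R') {c : X.Chamber} {i : B}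
    (hc : ∀ᶠ n in atTop, cs.Dn (cs.simple i) (mm (R n) c)) :
    ∀ᶠ n in atTop, cs.Dn (cs.simple i) (mm (R' n) c) := by
  have := hlf.1
  have key : ∀ a b : X.Chamber, (∃ᶠ n in atTop, mm (R' n) a = mm (R' n) b) →
      ∀ᶠ n in atTop, mm (R n) b = mm (R n) a := by
    intro a b hab
    obtain ⟨g, hg, rfl⟩ := exists_mem_asymStab hlf hGc hst hR' hab
    rw [← h] at hg
    exact hg a
  obtain ⟨p, hp, hm⟩ := hR.exists_adj hc
  refine (hR'.dn_or c i).resolve_right fun hc' => ?_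
  by_cases hpc : ∃ᶠ n in atTop, mm (R' n) c = mm (R' n) p
  · obtain ⟨n, h1, h2⟩ := ((key c p hpc).and hm).exists
    exact cs.length_simple_mul_ne (mm (R n) c) i (congrArg cs.length (h2.symm.trans h1))
  have hp' : ∀ᶠ n in atTop, mm (R' n) p = cs.simple i * mm (R' n) c := by
    filter_upwards [not_frequently.1 hpc] with n hn
    exact (mm_adj_pair (R' n) hp).resolve_right (Ne.symm hn)
  obtain ⟨q, hq, hqn⟩ := Set.exists_mem_notMem_of_ncard_lt_ncard (s := {c, p})
    (t := X.residue {i} c) (lt_of_le_of_lt (Set.ncard_insert_le c {p})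
      (by rw [Set.ncard_singleton]; exact hth _ ⟨i, c, rfl⟩))
  have hcq : X.delta c q = cs.simple i :=
    (mem_residue_singleton.1 hq).resolve_left fun e => hqn (Or.inl e.symm)
  have hpq : X.delta p q = cs.simple i := by
    have h1 : q ∈ X.residue {i} p := by
      rwa [← X.residue_eq (mem_residue_singleton.2 (Or.inr hp))]
    exact (mem_residue_singleton.1 h1).resolve_left fun e => hqn (Or.inr e.symm)
  have hq' : ∀ᶠ n in atTop, mm (R' n) p = mm (R' n) q := by
    filter_upwards [hp', hc'] with n h1 h2
    refine h1.trans ((mm_adj_pair (R' n) hcq).resolve_right fun h3 => ?_).symm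
    have hpc := X.delta_simple_symm hp
    refine hqn (Or.inl (lift_unique (R := R' n) (c := p) (b := c) (b' := q) ?_ ?_ ?_ h3).symm)
    · rw [hpc, pre_simple_iff, h1, dn_simple_mul]
      exact h2
    · rw [hpc, h1, inv_simple, simple_mul_simple_cancel_left]
    · rw [hpc, hpq]
  obtain ⟨n, h1, h2, h3⟩ := ((key p q hq'.frequently).and (hm.and hc)).exists
  refine hqn (Or.inr (lift_unique (R := R n) (c := c) (b := p) (b' := q) ?_ ?_ ?_ h1).symm)
  · rwa [hp, pre_simple_iff]
  · rw [hp, h2, inv_simple]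
  · rw [hp, hcq]

theorem injective_DxiC (hlf : X.LocallyFinite) (hGc : IsClosed (G : Set X.Aut))
    (hst : X.StronglyTransitive G)
    (hth : X.Thick) : Function.Injective fun ξ : X.Cr => X.DxiC G ξ.1 := by
  rintro ⟨ξ, hξ⟩ ⟨ζ, hζ⟩ h
  obtain ⟨R, hR⟩ := exists_convSeq hlf hξ
  obtain ⟨R', hR'⟩ := exists_convSeq hlf hζ
  have h1 : asymStab G R = asymStab G R' := by
    rw [← DxiC_coe hlf hGc hst hR, ← DxiC_coe hlf hGc hst hR']
    exact congrArg (fun L : ChabautySpace G => (L.1 : Set G)) h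
  have := hlf.1
  refine Subtype.ext (funext fun σ => res_ext (Set.ext fun q => ?_))
  change q ∈ (ξ σ).1 ↔ q ∈ (ζ σ).1
  rw [hR.mem_limit_iff, hR'.mem_limit_iff]
  have h2 : ∀ i, (∀ᶠ n in atTop, cs.Dn (cs.simple i) (mm (R n) q)) ↔
      ∀ᶠ n in atTop, cs.Dn (cs.simple i) (mm (R' n) q) := fun i =>
    ⟨eventually_dn_of_asymStab_eq hlf hGc hst hth hR hR' h1,
      eventually_dn_of_asymStab_eq hlf hGc hst hth hR' hR h1.symm⟩
  simp only [h2]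

end Bldg

/-- for a thick locally finite building with a strongly transitive
closed subgroup `G ≤ Aut(X)`, the map `ξ ↦ D_ξ` is a `G`-equivariant
homeomorphism from `Cr(X)` onto the group-theoretic compactification `Cg(X)`
(the Chabauty closure of the set of residue stabilisers); moreover a sequence of
residues converges to `ξ` iff their stabilisers converge to `D_ξ` in the
Chabauty topology. -/
theorem statement15 {cs : CoxeterSystem M W} (X : Bldg cs)
    (hlf : X.LocallyFinite) (hth : X.Thick)
    (G : Subgroup X.Aut) (hGc : IsClosed (G : Set X.Aut))
    (hst : X.StronglyTransitive G) :
    Topology.IsEmbedding (fun ξ : ↥X.Cr => X.DxiC G ξ.1) ∧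
    Set.range (fun ξ : ↥X.Cr => X.DxiC G ξ.1) =
      closure (Set.range fun R : X.Res => X.gstabC G R) ∧
    (∀ (g : ↥G) (ξ ζ : ↥X.Cr), X.actCr (g : X.Aut) ξ.1 = ζ.1 →
      ((X.DxiC G ζ.1).1 : Set ↥G) =
        (fun h => g * h * g⁻¹) '' ((X.DxiC G ξ.1).1 : Set ↥G)) ∧
    ∀ (R : ℕ → X.Res) (ξ : X.Res → X.Res), ξ ∈ X.Cr →
      (Tendsto (fun n => X.projr (R n)) atTop (nhds ξ) ↔
        Tendsto (fun n => X.gstabC G (R n)) atTop (nhds (X.DxiC G ξ))) := by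
  have hcont := Bldg.continuous_DxiC hlf hGc hst
  have hcpt : CompactSpace X.Cr := isCompact_iff_compactSpace.1 (Bldg.isCompact_Cr hlf)
  have ht2 := Bldg.t2Space_chabauty hlf hGc
  have hcl := hcont.isClosedEmbedding (Bldg.injective_DxiC hlf hGc hst hth)
  have hmem : ∀ T, X.projr T ∈ X.Cr := fun T => subset_closure ⟨T, rfl⟩
  refine ⟨hcl.isEmbedding, ?_, ?_, ?_⟩
  · refine Set.Subset.antisymm ?_ (closure_minimal ?_ hcl.isClosed_range)
    · rintro _ ⟨⟨ξ, hξ⟩, rfl⟩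
      obtain ⟨R, hR⟩ := Bldg.exists_convSeq hlf hξ
      exact mem_closure_of_tendsto (Bldg.tendsto_gstabC hlf hGc hst hR)
        (Eventually.of_forall fun n => ⟨R n, rfl⟩)
    · rintro _ ⟨T, rfl⟩
      exact ⟨⟨X.projr T, hmem T⟩, (Bldg.gstabC_eq_DxiC hlf hGc hst T).symm⟩
  · intro g ξ ζ hgξ
    obtain ⟨R, hR⟩ := Bldg.exists_convSeq hlf ξ.2
    rw [← hgξ, Bldg.DxiC_coe hlf hGc hst (hR.actRes g), Bldg.DxiC_coe hlf hGc hst hR,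
      Bldg.asymStab_actRes]
  · intro R ξ hξ
    refine ⟨Bldg.tendsto_gstabC hlf hGc hst, fun h => ?_⟩
    have h1 : Tendsto (fun n => (⟨X.projr (R n), hmem (R n)⟩ : X.Cr)) atTop (𝓝 ⟨ξ, hξ⟩) := by
      refine hcl.isEmbedding.tendsto_nhds_iff.2 (h.congr fun n => ?_)
      exact Bldg.gstabC_eq_DxiC hlf hGc hst (R n)
    exact tendsto_subtype_rng.1 h1
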